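/- arXiv:2412.01392 — 3 statements merged into one kernel-verified Lean document; each statement's English description precedes it below -/
import Mathlib

section
/- Let R be a local ring, M and N finitely generated R-modules with g = CI-dim_R(M) < ∞. Assume depth_R(N) ≥ g, and for some positive integer r ≤ g and all i = r,...,g, either depth_R(Tor_i^R(M,N)) = 0 or Tor_i^R(M,N) = 0. Then Tor_i^R(M,N) = 0 for all i ≫ 0 if and only if Tor_i^R(M,N) = 0 for all i ≥ r. -/
open CategoryTheory

noncomputable section

universe u

variable (R : Type u) [CommRing R]

/-- The `i`-th Ext module of two `R`-modules. -/
abbrev ExtMod (i : ℕ) (M N : ModuleCat.{u} R) : ModuleCat.{u} R :=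
  ((Ext R (ModuleCat.{u} R) i).obj (Opposite.op M)).obj N

/-- The `i`-th Tor module of two `R`-modules. -/
abbrev TorMod (i : ℕ) (M N : ModuleCat.{u} R) : ModuleCat.{u} R :=
  ((Tor' (ModuleCat.{u} R) i).obj M).obj N

/-- `D^⊥`. -/
def perpSet (D : Set (ModuleCat.{u} R)) : Set (ModuleCat.{u} R) :=
  {Y | ∀ X ∈ D, ∀ i : ℕ, 0 < i → Subsingleton (ExtMod R i X Y)}

/-- `E^⊤`. -/
def topSet (E : Set (ModuleCat.{u} R)) : Set (ModuleCat.{u} R) :=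
  {X | ∀ Y ∈ E, ∀ i : ℕ, 0 < i → Subsingleton (ExtMod R i X Y)}

/-- depth via maximal lengths of regular sequences in the maximal ideal. -/
def depth [IsLocalRing R] (M : ModuleCat.{u} R) : ℕ :=
  sSup {n | ∃ rs : List R, rs.length = n ∧ (∀ r ∈ rs, r ∈ IsLocalRing.maximalIdeal R) ∧
    RingTheory.Sequence.IsRegular M rs}

/-- `pd_R M ≤ n` via free syzygies. -/
def ProjDimLE : ℕ → ModuleCat.{u} R → Prop
  | 0, M => Projective M
  | n+1, M => ∃ (K F : ModuleCat.{u} R) (f : K ⟶ F) (g : F ⟶ M) (w : f ≫ g = 0),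
      Module.Free R F ∧ (ShortComplex.mk f g w).ShortExact ∧ ProjDimLE n K

/-- Projective dimension, in `ℕ∞`. -/
def projDim (M : ModuleCat.{u} R) : ℕ∞ :=
  sInf {d : ℕ∞ | ∃ n : ℕ, d = n ∧ ProjDimLE R n M}

/-- Totally reflexive modules. -/
def TotallyReflexive (M : ModuleCat.{u} R) : Prop :=
  Function.Bijective (Module.Dual.eval R M) ∧
  (∀ i : ℕ, 0 < i → Subsingleton (ExtMod R i M (ModuleCat.of R R))) ∧
  (∀ i : ℕ, 0 < i → Subsingleton (ExtMod R i (ModuleCat.of R (Module.Dual R M)) (ModuleCat.of R R)))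

/-- `G-dim_R M ≤ n` via syzygies. -/
def GdimLE : ℕ → ModuleCat.{u} R → Prop
  | 0, M => TotallyReflexive R M
  | n+1, M => ∃ (K F : ModuleCat.{u} R) (f : K ⟶ F) (g : F ⟶ M) (w : f ≫ g = 0),
      Module.Free R F ∧ (ShortComplex.mk f g w).ShortExact ∧ GdimLE n K

/-- Gorenstein dimension, in `ℕ∞`. -/
def Gdim (M : ModuleCat.{u} R) : ℕ∞ :=
  sInf {d : ℕ∞ | ∃ n : ℕ, d = n ∧ GdimLE R n M}

/-- `M` is an `n`-th syzygy module. -/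
def IsNthSyzygy : ℕ → ModuleCat.{u} R → Prop
  | 0, _ => True
  | n+1, M => ∃ (F C : ModuleCat.{u} R) (f : M ⟶ F) (g : F ⟶ C) (w : f ≫ g = 0),
      Module.Free R F ∧ (ShortComplex.mk f g w).ShortExact ∧ IsNthSyzygy n C

/-- `syz_R M`: the largest `t ≤ depth R` such that `M` is a `t`-th syzygy. -/
def syz [IsLocalRing R] (M : ModuleCat.{u} R) : ℕ :=
  sSup {t | t ≤ depth R (ModuleCat.of R R) ∧ IsNthSyzygy R t M}

/-- Complexity of a sequence of natural numbers. -/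
def seqComplexity (b : ℕ → ℕ) : ℕ :=
  sInf {r : ℕ | ∃ α : ℝ, ∀ᶠ n in Filter.atTop, (b n : ℝ) ≤ α * (n : ℝ) ^ ((r : ℝ) - 1)}

/-- Minimal number of generators. -/
def numGen (M : ModuleCat.{u} R) : ℕ :=
  sInf {n | ∃ s : Finset M, s.card = n ∧ Submodule.span R (s : Set M) = ⊤}

/-- Complexity of a pair of modules. -/
def cx (M N : ModuleCat.{u} R) : ℕ :=
  seqComplexity (fun i => numGen R (ExtMod R i M N))

/-- Regular local ring: Noetherian local, maximal ideal generated by a regular sequence. -/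
def IsRegularLocal (Q : Type u) [CommRing Q] : Prop :=
  IsLocalRing Q ∧ IsNoetherianRing Q ∧
  ∃ rs : List Q, RingTheory.Sequence.IsRegular Q rs ∧ (Ideal.span {x | x ∈ rs}).IsMaximal

/-- Local complete intersection ring: the completion is a regular local ring
modulo a regular sequence. -/
def IsCompleteIntersectionLocal (R : Type u) [CommRing R] [IsLocalRing R] : Prop :=
  ∃ (Q : CommRingCat.{u})
    (φ : ↥Q →+* AdicCompletion (IsLocalRing.maximalIdeal R) R),
    IsRegularLocal ↥Q ∧ Function.Surjective φ ∧
    ∃ rs : List ↥Q, RingTheory.Sequence.IsRegular (↥Q) rs ∧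
      RingHom.ker φ = Ideal.span {x | x ∈ rs}

/-- Gorenstein local ring: `R` has finite injective dimension over itself,
expressed via eventual vanishing of `Ext^i(-, R)`. -/
def IsGorensteinLocal (R : Type u) [CommRing R] : Prop :=
  IsLocalRing R ∧ IsNoetherianRing R ∧
  ∃ n : ℕ, ∀ (M : ModuleCat.{u} R) (i : ℕ), n < i → Subsingleton (ExtMod R i M (ModuleCat.of R R))


open scoped TensorProduct in
/-- A quasi-deformation `R → R' ← Q` of a local ring `R`. -/
structure QuasiDeformation (R : Type u) [CommRing R] [IsLocalRing R] : Type (u+1) where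
  R' : CommRingCat.{u}
  Q : CommRingCat.{u}
  localR' : IsLocalRing ↥R'
  localQ : IsLocalRing ↥Q
  φ : R →+* ↥R'
  ψ : ↥Q →+* ↥R'
  isLocalHom : IsLocalHom φ
  faithfullyFlat : letI := φ.toAlgebra; Module.FaithfullyFlat R ↥R'
  surj : Function.Surjective ψ
  ker_reg : ∃ rs : List ↥Q, RingTheory.Sequence.IsRegular (↥Q) rs ∧
    RingHom.ker ψ = Ideal.span {x | x ∈ rs}

open scoped TensorProduct in
/-- Complete intersection dimension of a module. -/
def CIdim (R : Type u) [CommRing R] [IsLocalRing R] (M : ModuleCat.{u} R) : ℕ∞ :=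
  sInf {d : ℕ∞ | ∃ D : QuasiDeformation R,
    letI := D.φ.toAlgebra
    letI : Module ↥D.Q ↥D.R' := Module.compHom _ D.ψ
    letI : Module ↥D.Q (↥D.R' ⊗[R] ↥M) := Module.compHom _ D.ψ
    d = projDim ↥D.Q (ModuleCat.of ↥D.Q (↥D.R' ⊗[R] ↥M)) -
          projDim ↥D.Q (ModuleCat.of ↥D.Q ↥D.R')}

open CategoryTheory.Abelian

section ExtFull

variable {A : Type u} [CommRing A]

lemma smul_top_eq_top_of_surjective {E F : Type*} [AddCommGroup E] [Module A E]
    [AddCommGroup F] [Module A F] {I : Ideal A} (f : E →ₗ[A] F) (hf : Function.Surjective f)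
    (h : I • (⊤ : Submodule A E) = ⊤) : I • (⊤ : Submodule A F) = ⊤ := by
  have := congrArg (Submodule.map f) h
  rwa [Submodule.map_smul'', Submodule.map_top, LinearMap.range_eq_top.2 hf] at this

lemma smul_top_eq_top_iff_of_equiv {E F : Type*} [AddCommGroup E] [Module A E]
    [AddCommGroup F] [Module A F] (I : Ideal A) (e : E ≃ₗ[A] F) :
    I • (⊤ : Submodule A E) = ⊤ ↔ I • (⊤ : Submodule A F) = ⊤ :=
  ⟨smul_top_eq_top_of_surjective e.toLinearMap e.surjective,
    smul_top_eq_top_of_surjective e.symm.toLinearMap e.symm.surjective⟩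

/-- The module `Ext^i(M, D)` is equal to `I • Ext^i(M, D)`. -/
def ExtFull (I : Ideal A) (i : ℕ) (M D : ModuleCat.{u} A) : Prop :=
  I • (⊤ : Submodule A (Abelian.Ext M D i)) = ⊤

lemma extFull_bot {i : ℕ} {M D : ModuleCat.{u} A} :
    ExtFull ⊥ i M D ↔ Subsingleton (Abelian.Ext M D i) := by
  rw [ExtFull, Submodule.bot_smul, ← Submodule.subsingleton_iff A, subsingleton_iff_bot_eq_top]

/-- Precomposition with the class of a short exact sequence is an isomorphism in positive degrees
when the middle term is projective. -/
def extShiftEquiv {S : ShortComplex (ModuleCat.{u} A)} (hS : S.ShortExact) [Projective S.X₂]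
    (D : ModuleCat.{u} A) (i : ℕ) (hi : 0 < i) :
    Abelian.Ext S.X₁ D i ≃ₗ[A] Abelian.Ext S.X₃ D (i + 1) :=
  LinearEquiv.ofBijective (Ext.precompOfLinear hS.extClass A D (add_comm 1 i)) <| by
    constructor
    · rw [injective_iff_map_eq_zero]
      intro x hx
      obtain ⟨y, rfl⟩ := Ext.contravariant_sequence_exact₁ hS D x (add_comm 1 i) hx
      obtain ⟨j, rfl⟩ := Nat.exists_eq_succ_of_ne_zero hi.ne'
      rw [Ext.eq_zero_of_projective y, Ext.comp_zero]
    · exact precomp_extClass_surjective_of_projective_X₂ D hS i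

lemma extFull_shift {S : ShortComplex (ModuleCat.{u} A)} (hS : S.ShortExact) [Projective S.X₂]
    (D : ModuleCat.{u} A) {i : ℕ} (hi : 0 < i) (I : Ideal A) :
    ExtFull I (i + 1) S.X₃ D ↔ ExtFull I i S.X₁ D :=
  (smul_top_eq_top_iff_of_equiv I (extShiftEquiv hS D i hi)).symm

/-- The connecting homomorphism `Hom(X₁, D) → Ext¹(X₃, D)`. -/
def extOneMap {S : ShortComplex (ModuleCat.{u} A)} (hS : S.ShortExact) (D : ModuleCat.{u} A) :
    (S.X₁ →ₗ[A] D) →ₗ[A] Abelian.Ext S.X₃ D 1 :=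
  (Ext.precompOfLinear hS.extClass A D (add_zero 1)) ∘ₗ
    (Ext.linearEquiv₀ (R := A)).symm.toLinearMap ∘ₗ
      (ModuleCat.homLinearEquiv (S := A)).symm.toLinearMap

lemma extOneMap_surjective {S : ShortComplex (ModuleCat.{u} A)} (hS : S.ShortExact)
    [Projective S.X₂] (D : ModuleCat.{u} A) : Function.Surjective (extOneMap hS D) := by
  intro x
  obtain ⟨y, rfl⟩ := precomp_extClass_surjective_of_projective_X₂ D hS 0 x
  refine ⟨(Ext.linearEquiv₀ (R := A) (X := S.X₁) (Y := D) y).hom, ?_⟩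
  exact congrArg (fun z => hS.extClass.comp z (add_zero 1)) (Ext.mk₀_linearEquiv₀_apply (R := A) y)

lemma extOneMap_eq_zero_iff {S : ShortComplex (ModuleCat.{u} A)} (hS : S.ShortExact)
    (D : ModuleCat.{u} A) (φ : S.X₁ →ₗ[A] D) :
    extOneMap hS D φ = 0 ↔ ∃ ψ : S.X₂ →ₗ[A] D, ψ ∘ₗ S.f.hom = φ := by
  constructor
  · intro h
    obtain ⟨y, hy⟩ := Ext.contravariant_sequence_exact₁ hS D (Ext.mk₀ (ModuleCat.ofHom φ))
      (add_zero 1) h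
    obtain ⟨y, rfl⟩ := Ext.addEquiv₀.symm.surjective y
    refine ⟨y.hom, ?_⟩
    rw [Ext.addEquiv₀_symm_apply, Ext.mk₀_comp_mk₀] at hy
    have := (Ext.mk₀_bijective _ _).1 hy
    simpa using congrArg ModuleCat.Hom.hom this
  · rintro ⟨ψ, rfl⟩
    change hS.extClass.comp (Ext.mk₀ (S.f ≫ ModuleCat.ofHom ψ)) (add_zero 1) = 0
    rw [← Ext.mk₀_comp_mk₀, ← Ext.comp_assoc_of_second_deg_zero]
    simp

lemma extFull_one_iff {S : ShortComplex (ModuleCat.{u} A)} (hS : S.ShortExact) [Projective S.X₂]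
    (D : ModuleCat.{u} A) (I : Ideal A) :
    ExtFull I 1 S.X₃ D ↔ ∀ φ : S.X₁ →ₗ[A] D, ∃ ψ : S.X₂ →ₗ[A] D,
      φ - ψ ∘ₗ S.f.hom ∈ I • (⊤ : Submodule A (S.X₁ →ₗ[A] D)) := by
  have key : I • (⊤ : Submodule A (Abelian.Ext S.X₃ D 1)) =
      (I • (⊤ : Submodule A (S.X₁ →ₗ[A] D))).map (extOneMap hS D) := by
    rw [Submodule.map_smul'', Submodule.map_top,
      LinearMap.range_eq_top.2 (extOneMap_surjective hS D)]
  rw [ExtFull, key, eq_top_iff]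
  constructor
  · intro h φ
    obtain ⟨χ, hχ, e⟩ := h (show extOneMap hS D φ ∈ ⊤ from trivial)
    have : extOneMap hS D (φ - χ) = 0 := by rw [map_sub, e, sub_self]
    obtain ⟨ψ, hψ⟩ := (extOneMap_eq_zero_iff hS D _).1 this
    exact ⟨ψ, by rw [hψ, sub_sub_cancel]; exact hχ⟩
  · intro h x _
    obtain ⟨φ, rfl⟩ := extOneMap_surjective hS D x
    obtain ⟨ψ, hψ⟩ := h φ
    refine ⟨_, hψ, ?_⟩
    rw [map_sub, (extOneMap_eq_zero_iff hS D _).2 ⟨ψ, rfl⟩, sub_zero]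

lemma extFull_congr {M M' : ModuleCat.{u} A} (e : M ≅ M') {D : ModuleCat.{u} A} {i : ℕ}
    {I : Ideal A} (h : ExtFull I i M D) : ExtFull I i M' D := by
  refine smul_top_eq_top_of_surjective (Ext.precompOfLinear (Ext.mk₀ e.inv) A D (zero_add i)) ?_ h
  intro x
  refine ⟨(Ext.mk₀ e.hom).comp x (zero_add i), ?_⟩
  simp

end ExtFull

section BaseChange

open TensorProduct

variable {A : Type u} [CommRing A] (B : Type u) [CommRing B] [Algebra A B]

/-- The base change of a short complex of modules. -/
def baseChangeComplex (S : ShortComplex (ModuleCat.{u} A)) : ShortComplex (ModuleCat.{u} B) where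
  X₁ := ModuleCat.of B (B ⊗[A] S.X₁)
  X₂ := ModuleCat.of B (B ⊗[A] S.X₂)
  X₃ := ModuleCat.of B (B ⊗[A] S.X₃)
  f := ModuleCat.ofHom (S.f.hom.baseChange B)
  g := ModuleCat.ofHom (S.g.hom.baseChange B)
  zero := by
    rw [← ModuleCat.ofHom_comp, ← LinearMap.baseChange_comp, ← ModuleCat.hom_comp, S.zero]
    simp

lemma baseChangeComplex_shortExact {S : ShortComplex (ModuleCat.{u} A)} (hS : S.ShortExact)
    (hf : Function.Injective (S.f.hom.baseChange B)) : (baseChangeComplex B S).ShortExact := by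
  apply ModuleCat.shortComplex_shortExact
  · exact lTensor_exact B ((ShortComplex.ShortExact.moduleCat_exact_iff_function_exact S).1 hS.exact)
      hS.moduleCat_surjective_g
  · exact hf
  · exact LinearMap.lTensor_surjective B hS.moduleCat_surjective_g

lemma extFull_one_baseChange {S : ShortComplex (ModuleCat.{u} A)} (hS : S.ShortExact)
    [Module.Free A S.X₂] (hf : Function.Injective (S.f.hom.baseChange B))
    (D : Type u) [AddCommGroup D] [Module A D] [Module B D] [IsScalarTower A B D] (I : Ideal A) :
    ExtFull I 1 S.X₃ (ModuleCat.of A D) ↔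
      ExtFull (I.map (algebraMap A B)) 1 (ModuleCat.of B (B ⊗[A] S.X₃)) (ModuleCat.of B D) := by
  have hSB := baseChangeComplex_shortExact B hS hf
  have : Projective (baseChangeComplex B S).X₂ :=
    ModuleCat.projective_of_free (Module.Free.chooseBasis B (B ⊗[A] S.X₂))
  have : Projective S.X₂ := ModuleCat.projective_of_free (Module.Free.chooseBasis A S.X₂)
  let e₁ : (S.X₁ →ₗ[A] D) ≃ₗ[B] (B ⊗[A] S.X₁ →ₗ[B] D) := LinearMap.liftBaseChangeEquiv B
  let e₂ : (S.X₂ →ₗ[A] D) ≃ₗ[B] (B ⊗[A] S.X₂ →ₗ[B] D) := LinearMap.liftBaseChangeEquiv B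
  have hcomp (ψ : S.X₂ →ₗ[A] D) : e₁ (ψ ∘ₗ S.f.hom) = e₂ ψ ∘ₗ S.f.hom.baseChange B := by
    ext; simp [e₁, e₂]
  have hmem (χ : S.X₁ →ₗ[A] D) : χ ∈ I • (⊤ : Submodule A (S.X₁ →ₗ[A] D)) ↔
      e₁ χ ∈ I.map (algebraMap A B) • (⊤ : Submodule B (B ⊗[A] S.X₁ →ₗ[B] D)) := by
    have h1 : (I.map (algebraMap A B) • (⊤ : Submodule B (B ⊗[A] S.X₁ →ₗ[B] D))) =
        (I.map (algebraMap A B) • (⊤ : Submodule B (S.X₁ →ₗ[A] D))).map e₁.toLinearMap := by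
      rw [Submodule.map_smul'', Submodule.map_top, LinearEquiv.range]
    have h2 := Ideal.smul_restrictScalars I (⊤ : Submodule B (S.X₁ →ₗ[A] D))
    rw [Submodule.restrictScalars_top] at h2
    rw [h1, ← h2, Submodule.restrictScalars_mem]
    exact ⟨fun h => ⟨χ, h, rfl⟩, fun ⟨y, hy, e⟩ => e₁.injective e ▸ hy⟩
  refine (extFull_one_iff hS (ModuleCat.of A D) I).trans
    (Iff.trans ?_ (extFull_one_iff hSB (ModuleCat.of B D) _).symm)
  constructor
  · intro h φ
    obtain ⟨φ, rfl⟩ := e₁.surjective φ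
    obtain ⟨ψ, hψ⟩ := h φ
    refine ⟨e₂ ψ, ?_⟩
    have := (hmem _).1 hψ
    rwa [map_sub, hcomp] at this
  · intro h φ
    obtain ⟨ψ, hψ⟩ := h (e₁ φ)
    obtain ⟨ψ, rfl⟩ := e₂.surjective ψ
    refine ⟨ψ, (hmem _).2 ?_⟩
    rw [map_sub, hcomp]
    exact hψ

/-- Change of rings, for modules in a class closed under syzygies whose syzygy sequences stay exact
after base change. -/
lemma extFull_baseChange (P : ModuleCat.{u} A → Prop)
    (hP : ∀ S : ShortComplex (ModuleCat.{u} A), S.ShortExact → Module.Free A S.X₂ → P S.X₃ →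
      P S.X₁ ∧ Function.Injective (S.f.hom.baseChange B))
    (D : Type u) [AddCommGroup D] [Module A D] [Module B D] [IsScalarTower A B D]
    (I : Ideal A) {i : ℕ} (hi : 0 < i) (K : ModuleCat.{u} A) (hK : P K) :
    ExtFull I i K (ModuleCat.of A D) ↔
      ExtFull (I.map (algebraMap A B)) i (ModuleCat.of B (B ⊗[A] K)) (ModuleCat.of B D) := by
  induction i, hi using Nat.le_induction generalizing K with
  | base =>
    have hS := K.shortExact_projectiveShortComplex
    exact extFull_one_baseChange B hS (hP _ hS inferInstance hK).2 D I
  | succ i hi ih =>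
    have hS := K.shortExact_projectiveShortComplex
    obtain ⟨h₁, hf⟩ := hP _ hS inferInstance hK
    have hSB := baseChangeComplex_shortExact B hS hf
    have : Projective (baseChangeComplex B K.projectiveShortComplex).X₂ :=
      ModuleCat.projective_of_free
        (Module.Free.chooseBasis B (B ⊗[A] K.projectiveShortComplex.X₂))
    have : Projective K.projectiveShortComplex.X₂ :=
      ModuleCat.projective_of_free (Module.Free.chooseBasis A K.projectiveShortComplex.X₂)
    exact (extFull_shift hS _ hi I).trans ((ih _ h₁).trans (extFull_shift hSB _ hi _).symm)

lemma extFull_baseChange_of_flat [Module.Flat A B]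
    (D : Type u) [AddCommGroup D] [Module A D] [Module B D] [IsScalarTower A B D]
    (I : Ideal A) {i : ℕ} (hi : 0 < i) (K : ModuleCat.{u} A) :
    ExtFull I i K (ModuleCat.of A D) ↔
      ExtFull (I.map (algebraMap A B)) i (ModuleCat.of B (B ⊗[A] K)) (ModuleCat.of B D) := by
  refine extFull_baseChange B (fun _ => True) (fun S hS _ _ => ⟨trivial, ?_⟩) D I hi K trivial
  have := Module.Flat.lTensor_preserves_injective_linearMap (M := B) S.f.hom
    hS.moduleCat_injective_f
  exact this

end BaseChange

section Hypersurface

open TensorProduct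

variable {A B : Type u} [CommRing A] [CommRing B] [Algebra A B]

lemma exists_one_tmul_of_surjective (hs : Function.Surjective (algebraMap A B))
    {X : Type*} [AddCommGroup X] [Module A X] (z : B ⊗[A] X) : ∃ k : X, z = 1 ⊗ₜ k := by
  induction z with
  | zero => exact ⟨0, by simp⟩
  | tmul b y =>
    obtain ⟨a, rfl⟩ := hs b
    exact ⟨a • y, by rw [TensorProduct.tmul_smul, TensorProduct.smul_tmul',
      Algebra.smul_def, mul_one]⟩
  | add y z hy hz =>
    obtain ⟨k, rfl⟩ := hy
    obtain ⟨l, rfl⟩ := hz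
    exact ⟨k + l, (TensorProduct.tmul_add _ _ _).symm⟩

lemma one_tmul_eq_zero_iff_of_ker_eq (hs : Function.Surjective (algebraMap A B)) {x : A}
    (hx : RingHom.ker (algebraMap A B) = Ideal.span {x})
    {X : Type*} [AddCommGroup X] [Module A X] (k : X) :
    (1 : B) ⊗ₜ[A] k = 0 ↔ ∃ u : X, k = x • u := by
  have hx0 : algebraMap A B x = 0 := by
    rw [← RingHom.mem_ker, hx]
    exact Ideal.mem_span_singleton_self x
  constructor
  · intro h
    have hex : Function.Exact (LinearMap.mulLeft A x) (Algebra.linearMap A B) := by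
      intro a
      rw [Algebra.linearMap_apply, ← RingHom.mem_ker, hx, Ideal.mem_span_singleton']
      constructor
      · rintro ⟨b, rfl⟩
        exact ⟨b, mul_comm _ _⟩
      · rintro ⟨b, rfl⟩
        exact ⟨b, mul_comm _ _⟩
    obtain ⟨y, hy⟩ := (rTensor_exact X hex hs ((1 : A) ⊗ₜ[A] k)).1 (by simpa using h)
    refine ⟨TensorProduct.lid A X y, ?_⟩
    have h2 : ∀ y : A ⊗[A] X, TensorProduct.lid A X ((LinearMap.mulLeft A x).rTensor X y) =
        x • TensorProduct.lid A X y := by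
      intro y
      induction y with
      | zero => simp
      | tmul a z => simp [mul_smul]
      | add y z hy hz => simp [hy, hz]
    rw [← h2, hy, TensorProduct.lid_tmul, one_smul]
  · rintro ⟨u, rfl⟩
    rw [TensorProduct.tmul_smul, TensorProduct.smul_tmul', Algebra.smul_def, hx0, zero_mul,
      TensorProduct.zero_tmul]

lemma isSMulRegular_of_free {x : A} (hx : IsSMulRegular A x) (F : Type*) [AddCommGroup F]
    [Module A F] [Module.Free A F] : IsSMulRegular F x := by
  let b := Module.Free.chooseBasis A F
  intro u v huv
  apply b.repr.injective
  ext i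
  apply hx
  simpa using congrArg (fun w => b.repr w i) huv

lemma isSMulRegular_syzygy_and_injective (hs : Function.Surjective (algebraMap A B)) {x : A}
    (hx : RingHom.ker (algebraMap A B) = Ideal.span {x}) (hreg : IsSMulRegular A x)
    (S : ShortComplex (ModuleCat.{u} A)) (hS : S.ShortExact) [Module.Free A S.X₂]
    (h₃ : IsSMulRegular S.X₃ x) :
    IsSMulRegular S.X₁ x ∧ Function.Injective (S.f.hom.baseChange B) := by
  have hinj := hS.moduleCat_injective_f
  have h₁ : IsSMulRegular S.X₁ x :=
    (isSMulRegular_of_free hreg S.X₂).of_injective S.f.hom hinj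
  refine ⟨h₁, ?_⟩
  rw [injective_iff_map_eq_zero]
  intro z hz
  obtain ⟨k, rfl⟩ := exists_one_tmul_of_surjective hs z
  rw [LinearMap.baseChange_tmul, one_tmul_eq_zero_iff_of_ker_eq hs hx] at hz
  obtain ⟨u, hu⟩ := hz
  have hgu : S.g.hom u = 0 := by
    apply h₃
    dsimp only
    rw [smul_zero, ← map_smul, ← hu]
    exact S.moduleCat_zero_apply k
  obtain ⟨v, rfl⟩ :=
    ((ShortComplex.ShortExact.moduleCat_exact_iff_function_exact S).1 hS.exact u).1 hgu
  rw [one_tmul_eq_zero_iff_of_ker_eq hs hx]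
  refine ⟨v, hinj ?_⟩
  exact hu.trans (S.f.hom.map_smul x v).symm

/-- The exact sequence `0 → M → B ⊗ K → L → 0` where `K` and `L` are the syzygies of a
`B`-module `M` over `A` and over `B = A / (x)`. -/
lemma exists_syzygy_sequence (hs : Function.Surjective (algebraMap A B)) {x : A}
    (hx : RingHom.ker (algebraMap A B) = Ideal.span {x}) (hreg : IsSMulRegular A x)
    (M : Type u) [AddCommGroup M] [Module A M] [Module B M] [IsScalarTower A B M]
    (S : ShortComplex (ModuleCat.{u} A)) (hS : S.ShortExact) [Module.Free A S.X₂]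
    (e : S.X₃ ≃ₗ[A] M) :
    ∃ S₁ S₂ : ShortComplex (ModuleCat.{u} B), S₁.ShortExact ∧ S₂.ShortExact ∧
      Projective S₁.X₂ ∧ S₁.X₃ = ModuleCat.of B M ∧ S₂.X₁ = ModuleCat.of B M ∧
      S₂.X₂ = ModuleCat.of B (B ⊗[A] S.X₁) ∧ S₂.X₃ = S₁.X₁ := by
  have hinj := hS.moduleCat_injective_f
  have hex := (ShortComplex.ShortExact.moduleCat_exact_iff_function_exact S).1 hS.exact
  have hregF : IsSMulRegular S.X₂ x := isSMulRegular_of_free hreg S.X₂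
  have hx0 : algebraMap A B x = 0 := by
    rw [← RingHom.mem_ker, hx]
    exact Ideal.mem_span_singleton_self x
  let g : S.X₂ →ₗ[A] M := e.toLinearMap ∘ₗ S.g.hom
  have hg : Function.Surjective g := e.surjective.comp hS.moduleCat_surjective_g
  have hgker (u) : g u = 0 ↔ ∃ k, S.f.hom k = u := by
    refine Iff.trans ?_ (hex u)
    exact e.map_eq_zero_iff
  have hxg (u : S.X₂) : ∃ k, S.f.hom k = x • u := by
    rw [← hgker, map_smul, algebra_compatible_smul B, hx0, zero_smul]
  choose σ hσ using hxg
  let G : B ⊗[A] S.X₂ →ₗ[B] M := g.liftBaseChange B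
  have hG : Function.Surjective G := fun m => by
    obtain ⟨u, rfl⟩ := hg m
    exact ⟨1 ⊗ₜ u, by simp [G]⟩
  let β : B ⊗[A] S.X₁ →ₗ[B] B ⊗[A] S.X₂ := S.f.hom.baseChange B
  have hGβ : ∀ z, G (β z) = 0 := by
    intro z
    obtain ⟨k, rfl⟩ := exists_one_tmul_of_surjective hs z
    simp only [β, G, LinearMap.baseChange_tmul, LinearMap.liftBaseChange_tmul, one_smul]
    exact (hgker _).2 ⟨k, rfl⟩
  let β' : B ⊗[A] S.X₁ →ₗ[B] LinearMap.ker G := β.codRestrict _ hGβ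
  have hβ' : Function.Surjective β' := by
    rintro ⟨z, hz⟩
    obtain ⟨u, rfl⟩ := exists_one_tmul_of_surjective hs z
    obtain ⟨k, rfl⟩ := (hgker u).1 (by simpa [G] using hz)
    exact ⟨1 ⊗ₜ k, Subtype.ext (LinearMap.baseChange_tmul ..)⟩
  let τ₀ : S.X₂ →ₗ[A] B ⊗[A] S.X₁ :=
    { toFun := fun u => 1 ⊗ₜ σ u
      map_add' := fun u v => by
        rw [← TensorProduct.tmul_add]
        congr 1
        apply hinj
        change S.f.hom _ = S.f.hom _
        rw [map_add, hσ, hσ, hσ, smul_add]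
      map_smul' := fun a u => by
        rw [RingHom.id_apply, ← TensorProduct.tmul_smul]
        congr 1
        apply hinj
        change S.f.hom _ = S.f.hom _
        rw [map_smul, hσ, hσ, smul_comm] }
  have hτ₀ (u) : τ₀ u = 0 ↔ g u = 0 := by
    change (1 : B) ⊗ₜ[A] σ u = 0 ↔ _
    rw [one_tmul_eq_zero_iff_of_ker_eq hs hx, hgker]
    refine exists_congr fun k => ⟨fun h => hregF ?_, fun h => hinj ?_⟩
    · change x • S.f.hom k = x • u
      rw [← map_smul, ← h, hσ]
    · change S.f.hom _ = S.f.hom _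
      rw [hσ, map_smul, h]
  let τ₁ : M →ₗ[A] B ⊗[A] S.X₁ :=
    (LinearMap.ker g).liftQ τ₀ (fun u hu => (hτ₀ u).2 hu) ∘ₗ
      (g.quotKerEquivOfSurjective hg).symm.toLinearMap
  have hτ₁ (u) : τ₁ (g u) = τ₀ u := by
    have : (g.quotKerEquivOfSurjective hg).symm (g u) = (LinearMap.ker g).mkQ u := by
      rw [LinearEquiv.symm_apply_eq]
      rfl
    simp only [τ₁, LinearMap.comp_apply, LinearEquiv.coe_coe, this]
    exact Submodule.liftQ_apply _ _ _
  let τ : M →ₗ[B] B ⊗[A] S.X₁ := τ₁.extendScalarsOfSurjective hs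
  have hτ (u) : τ (g u) = 1 ⊗ₜ σ u := hτ₁ u
  have hτinj : Function.Injective τ := by
    rw [injective_iff_map_eq_zero]
    intro m hm
    obtain ⟨u, rfl⟩ := hg m
    exact (hτ₀ u).1 ((hτ₁ u).symm.trans hm)
  have hexτ : Function.Exact τ β' := by
    intro z
    obtain ⟨k, rfl⟩ := exists_one_tmul_of_surjective hs z
    have : β' (1 ⊗ₜ k) = 0 ↔ (1 : B) ⊗ₜ[A] S.f.hom k = 0 := by
      exact Subtype.ext_iff
    rw [this, one_tmul_eq_zero_iff_of_ker_eq hs hx]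
    constructor
    · rintro ⟨u, hu⟩
      refine ⟨g u, ?_⟩
      rw [hτ]
      congr 1
      apply hinj
      exact (hσ u).trans hu.symm
    · rintro ⟨m, hm⟩
      obtain ⟨u, rfl⟩ := hg m
      rw [hτ] at hm
      have hm' : (1 : B) ⊗ₜ[A] (σ u - k) = 0 := by rw [TensorProduct.tmul_sub, hm, sub_self]
      obtain ⟨v, hv⟩ := (one_tmul_eq_zero_iff_of_ker_eq hs hx _).1 hm'
      refine ⟨u - S.f.hom v, ?_⟩
      rw [smul_sub, ← hσ, ← map_smul, ← hv, map_sub, sub_sub_cancel]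
  refine ⟨G.shortComplexKer, ModuleCat.shortComplexOfCompEqZero τ β' hexτ.linearMap_comp_eq_zero,
    LinearMap.shortExact_shortComplexKer hG, ?_, ?_, rfl, rfl, rfl, rfl⟩
  · exact ModuleCat.shortComplex_shortExact _ hexτ hτinj hβ'
  · exact ModuleCat.projective_of_free (Module.Free.chooseBasis B (B ⊗[A] S.X₂))

lemma ext_hypersurface (hs : Function.Surjective (algebraMap A B)) {x : A}
    (hx : RingHom.ker (algebraMap A B) = Ideal.span {x}) (hreg : IsSMulRegular A x)
    (M D : Type u) [AddCommGroup M] [Module A M] [Module B M] [IsScalarTower A B M]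
    [AddCommGroup D] [Module A D] [Module B D] [IsScalarTower A B D] {p : ℕ} (hp : 0 < p)
    (hv : ∀ i, p < i → Subsingleton (Abelian.Ext (ModuleCat.of B M) (ModuleCat.of B D) i)) :
    (∀ i, p + 1 < i → Subsingleton (Abelian.Ext (ModuleCat.of A M) (ModuleCat.of A D) i)) ∧
    ∀ I : Ideal A, ExtFull I (p + 1) (ModuleCat.of A M) (ModuleCat.of A D) →
      ExtFull (I.map (algebraMap A B)) p (ModuleCat.of B M) (ModuleCat.of B D) := by
  have hS := (ModuleCat.of A M).shortExact_projectiveShortComplex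
  set S := (ModuleCat.of A M).projectiveShortComplex with hSdef
  have hfree : Module.Free A S.X₂ := inferInstanceAs
    (Module.Free A (ModuleCat.of A M).projectiveShortComplex.X₂)
  have hproj : Projective S.X₂ := ModuleCat.projective_of_free (Module.Free.chooseBasis A S.X₂)
  obtain ⟨S₁, S₂, h₁, h₂, hproj₁, e₃, e₁, e₂, e⟩ :=
    exists_syzygy_sequence hs hx hreg M S hS (LinearEquiv.refl A M)
  have hregK : IsSMulRegular S.X₁ x :=
    (isSMulRegular_of_free hreg S.X₂).of_injective S.f.hom hS.moduleCat_injective_f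
  have hCR (I : Ideal A) {i : ℕ} (hi : 0 < i) :
      ExtFull I (i + 1) (ModuleCat.of A M) (ModuleCat.of A D) ↔
        ExtFull (I.map (algebraMap A B)) i S₂.X₂ (ModuleCat.of B D) := by
    rw [e₂]
    exact (extFull_shift hS _ hi I).trans (extFull_baseChange B (fun K => IsSMulRegular K x)
      (fun S hS _ h => isSMulRegular_syzygy_and_injective hs hx hreg S hS h) D I hi _ hregK)
  have hL (i : ℕ) (hi : p ≤ i) : Subsingleton (Abelian.Ext S₂.X₃ (ModuleCat.of B D) i) := by
    rw [e]
    have := hv (i + 1) (by omega)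
    rw [← e₃] at this
    exact (extShiftEquiv h₁ (ModuleCat.of B D) i (by omega)).toEquiv.subsingleton
  rw [← e₁] at hv ⊢
  constructor
  · intro i hi
    obtain ⟨i, rfl⟩ := Nat.exists_eq_add_of_lt hi
    rw [← extFull_bot, show p + 1 + i + 1 = (p + i + 1) + 1 by ring, hCR ⊥ (by omega),
      Ideal.map_bot, extFull_bot]
    have := hv (p + i + 1) (by omega)
    have := hL (p + i + 1) (by omega)
    refine subsingleton_of_forall_eq 0 fun y => ?_
    obtain ⟨z, rfl⟩ := Ext.contravariant_sequence_exact₂ h₂ (ModuleCat.of B D) y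
      (Subsingleton.elim _ _)
    rw [Subsingleton.elim z 0, Ext.comp_zero]
  · intro I hI
    rw [hCR I hp] at hI
    refine smul_top_eq_top_of_surjective
      (Ext.precompOfLinear (Ext.mk₀ S₂.f) B (ModuleCat.of B D) (zero_add p)) ?_ hI
    intro y
    have := hL (1 + p) (by omega)
    exact Ext.contravariant_sequence_exact₁ h₂ (ModuleCat.of B D) y rfl (Subsingleton.elim _ _)

end Hypersurface

section CompleteIntersection

open TensorProduct RingTheory.Sequence
open scoped Pointwise

lemma extFull_of_bijective {A B : Type u} [CommRing A] [CommRing B] [Algebra A B]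
    (hb : Function.Bijective (algebraMap A B))
    (M D : Type u) [AddCommGroup M] [Module A M] [Module B M] [IsScalarTower A B M]
    [AddCommGroup D] [Module A D] [Module B D] [IsScalarTower A B D] {p : ℕ} (hp : 0 < p)
    (I : Ideal A) :
    ExtFull I p (ModuleCat.of A M) (ModuleCat.of A D) ↔
      ExtFull (I.map (algebraMap A B)) p (ModuleCat.of B M) (ModuleCat.of B D) := by
  have : Module.Flat A B :=
    Module.Flat.of_linearEquiv (LinearEquiv.ofBijective (Algebra.linearMap A B) hb).symm
  let h : B ⊗[A] M →ₗ[B] M := (LinearMap.id : M →ₗ[A] M).liftBaseChange B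
  have hbij : Function.Bijective h := by
    constructor
    · rw [injective_iff_map_eq_zero]
      intro z hz
      obtain ⟨k, rfl⟩ := exists_one_tmul_of_surjective hb.2 z
      have : k = 0 := by simpa [h] using hz
      rw [this, TensorProduct.tmul_zero]
    · exact fun m => ⟨1 ⊗ₜ m, by simp [h]⟩
  let e : ModuleCat.of B (B ⊗[A] M) ≅ ModuleCat.of B M :=
    (LinearEquiv.ofBijective h hbij).toModuleIso
  rw [extFull_baseChange_of_flat B D I hp]
  exact ⟨extFull_congr e, extFull_congr e.symm⟩

lemma isWeaklyRegular_quotient_of_cons {A : Type*} [CommRing A] {x : A} {xs : List A}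
    (h : IsWeaklyRegular A (x :: xs)) :
    IsWeaklyRegular (A ⧸ Ideal.span {x}) (xs.map (Ideal.Quotient.mk (Ideal.span {x}))) := by
  have h2 := ((isWeaklyRegular_cons_iff' A x xs).1 h).2
  have heq : x • (⊤ : Submodule A A) = Ideal.span {x} := by
    ext y
    rw [Submodule.mem_smul_pointwise_iff_exists, Ideal.mem_span_singleton']
    simp [mul_comm]
  let e : QuotSMulTop x A ≃ₗ[A] A ⧸ Ideal.span {x} := Submodule.quotEquivOfEq _ _ heq
  exact ((e.extendScalarsOfSurjective Ideal.Quotient.mk_surjective).isWeaklyRegular_congr _).1 h2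

theorem ext_completeIntersection (n : ℕ) {A B : Type u} [CommRing A] [CommRing B] [Algebra A B]
    (hs : Function.Surjective (algebraMap A B)) (rs : List A) (hlen : rs.length = n)
    (hker : RingHom.ker (algebraMap A B) = Ideal.ofList rs) (hreg : IsWeaklyRegular A rs)
    (M D : Type u) [AddCommGroup M] [Module A M] [Module B M] [IsScalarTower A B M]
    [AddCommGroup D] [Module A D] [Module B D] [IsScalarTower A B D] {p : ℕ} (hp : 0 < p)
    (hv : ∀ i, p < i → Subsingleton (Abelian.Ext (ModuleCat.of B M) (ModuleCat.of B D) i)) :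
    (∀ i, p + n < i → Subsingleton (Abelian.Ext (ModuleCat.of A M) (ModuleCat.of A D) i)) ∧
    ∀ I : Ideal A, ExtFull I (p + n) (ModuleCat.of A M) (ModuleCat.of A D) →
      ExtFull (I.map (algebraMap A B)) p (ModuleCat.of B M) (ModuleCat.of B D) := by
  induction n generalizing A with
  | zero =>
    obtain rfl := List.length_eq_zero_iff.1 hlen
    rw [Ideal.ofList_nil, ← RingHom.injective_iff_ker_eq_bot] at hker
    have hb : Function.Bijective (algebraMap A B) := ⟨hker, hs⟩
    refine ⟨fun i hi => ?_, fun I => (extFull_of_bijective hb M D hp I).1⟩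
    rw [← extFull_bot, extFull_of_bijective hb M D (by omega), Ideal.map_bot, extFull_bot]
    exact hv i hi
  | succ n ih =>
    obtain ⟨x, xs, rfl⟩ := List.exists_cons_of_length_eq_add_one hlen
    let A' := A ⧸ Ideal.span {x}
    have hx : algebraMap A B x = 0 := by
      rw [← RingHom.mem_ker, hker, Ideal.ofList_cons]
      exact Ideal.mem_sup_left (Ideal.mem_span_singleton_self x)
    have hle : ∀ a ∈ Ideal.span {x}, algebraMap A B a = 0 := by
      intro a ha
      obtain ⟨b, rfl⟩ := Ideal.mem_span_singleton'.1 ha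
      rw [map_mul, hx, mul_zero]
    let φ : A' →+* B := Ideal.Quotient.lift _ (algebraMap A B) hle
    let : Algebra A' B := φ.toAlgebra
    let : Module A' M := Module.compHom M φ
    let : Module A' D := Module.compHom D φ
    have : IsScalarTower A' B M := ⟨fun a b m => mul_smul (φ a) b m⟩
    have : IsScalarTower A' B D := ⟨fun a b m => mul_smul (φ a) b m⟩
    have : IsScalarTower A A' B := IsScalarTower.of_algebraMap_eq fun a => rfl
    have : IsScalarTower A A' M := IsScalarTower.of_algebraMap_smul fun a m =>
      algebraMap_smul B a m
    have : IsScalarTower A A' D := IsScalarTower.of_algebraMap_smul fun a m =>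
      algebraMap_smul B a m
    have hs' : Function.Surjective (algebraMap A' B) :=
      Ideal.Quotient.lift_surjective_of_surjective _ hle hs
    have hker' : RingHom.ker (algebraMap A' B) =
        Ideal.ofList (xs.map (Ideal.Quotient.mk (Ideal.span {x}))) := by
      refine (Ideal.ker_quotient_lift _ hle).trans ?_
      rw [hker, Ideal.ofList_cons, Ideal.map_sup, Ideal.map_quotient_self, bot_sup_eq,
        Ideal.map_ofList]
    obtain ⟨h₁, h₂⟩ := ih hs' (xs.map (Ideal.Quotient.mk (Ideal.span {x}))) (by simpa using hlen)
      hker' (isWeaklyRegular_quotient_of_cons hreg)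
    obtain ⟨h₃, h₄⟩ := ext_hypersurface (B := A') (x := x) Ideal.Quotient.mk_surjective
      (Ideal.mk_ker) ((isWeaklyRegular_cons_iff' A x xs).1 hreg).1 M D
      (p := p + n) (by omega) h₁
    refine ⟨h₃, fun I hI => ?_⟩
    have := h₂ _ (h₄ I hI)
    rwa [Ideal.map_map] at this

end CompleteIntersection

section Codepth

open RingTheory.Sequence
open scoped Pointwise

variable {A : Type u} [CommRing A]

lemma mk_smul_eq_zero_quotSMulTop (y : A) {N : Type u} [AddCommGroup N] [Module A N] (n : N) :
    (Submodule.Quotient.mk (y • n) : QuotSMulTop y N) = 0 :=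
  (Submodule.Quotient.mk_eq_zero _).2
    (Submodule.smul_mem_pointwise_smul n y (⊤ : Submodule A N) Submodule.mem_top)

/-- The character dual of the sequence `N → N → N / yN`. -/
def characterQuotComplex (y : A) (N : Type u) [AddCommGroup N] [Module A N] :
    ShortComplex (ModuleCat.{u} A) where
  X₁ := ModuleCat.of A (CharacterModule (QuotSMulTop y N))
  X₂ := ModuleCat.of A (CharacterModule N)
  X₃ := ModuleCat.of A (CharacterModule N)
  f := ModuleCat.ofHom (CharacterModule.dual (Submodule.mkQ (y • (⊤ : Submodule A N))))
  g := y • 𝟙 _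
  zero := by
    ext (φ : CharacterModule (QuotSMulTop y N)) (n : N)
    change φ (Submodule.Quotient.mk (y • n)) = 0
    rw [mk_smul_eq_zero_quotSMulTop, map_zero]

lemma characterQuotComplex_shortExact {y : A} {N : Type u} [AddCommGroup N] [Module A N]
    (hy : IsSMulRegular N y) : (characterQuotComplex y N).ShortExact := by
  apply ModuleCat.shortComplex_shortExact
  · intro (φ : CharacterModule N)
    change y • φ = 0 ↔ _
    constructor
    · intro h
      have h' (n : N) : φ (y • n) = 0 := DFunLike.congr_fun h n
      refine ⟨QuotientAddGroup.lift (y • (⊤ : Submodule A N)).toAddSubgroup φ ?_, rfl⟩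
      rintro _ ⟨n, -, rfl⟩
      exact h' n
    · rintro ⟨(φ : CharacterModule (QuotSMulTop y N)), rfl⟩
      refine CharacterModule.ext N fun n => ?_
      change φ (Submodule.Quotient.mk (y • n)) = 0
      rw [mk_smul_eq_zero_quotSMulTop, map_zero]
  · exact CharacterModule.dual_injective_of_surjective _ (Submodule.mkQ_surjective _)
  · exact CharacterModule.dual_surjective_of_injective (LinearMap.lsmul A N y) hy

theorem extFull_characterModule_of_isWeaklyRegular (M : ModuleCat.{u} A) (ys : List A) (i : ℕ)
    (N : Type u) [AddCommGroup N] [Module A N] (hreg : IsWeaklyRegular N ys)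
    (hv : ∀ j, i < j → Subsingleton (Abelian.Ext M (ModuleCat.of A (CharacterModule N)) j))
    (hM : ∀ j, i + ys.length ≤ j → ∀ X : ModuleCat.{u} A, Subsingleton (Abelian.Ext M X j)) :
    ExtFull (Ideal.ofList ys) i M (ModuleCat.of A (CharacterModule N)) := by
  induction ys generalizing i N with
  | nil =>
    rw [Ideal.ofList_nil, extFull_bot]
    exact hM i le_rfl _
  | cons y ys ih =>
    obtain ⟨hy, hys⟩ := (isWeaklyRegular_cons_iff N y ys).1 hreg
    have hS := characterQuotComplex_shortExact hy
    have := hv (i + 1) (Nat.lt_succ_self i)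
    have hv' (j : ℕ) (hj : i + 1 < j) : Subsingleton
        (Abelian.Ext M (ModuleCat.of A (CharacterModule (QuotSMulTop y N))) j) := by
      obtain ⟨k, rfl⟩ := Nat.exists_eq_add_of_lt hj
      have h₁ := hv (i + 1 + k + 1) (by omega)
      have h₂ := hv (i + 1 + k) (by omega)
      refine subsingleton_of_forall_eq 0 fun x => ?_
      obtain ⟨z, rfl⟩ := Ext.covariant_sequence_exact₁ M hS x (Subsingleton.elim (h := h₁) _ _) rfl
      have hz : z = 0 := Subsingleton.elim (h := h₂) z 0
      rw [hz]
      exact Ext.zero_comp ..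
    have hfull := ih (i + 1) (QuotSMulTop y N) hys hv' fun j hj => hM j (by
      rw [List.length_cons]
      omega)
    let δ : Abelian.Ext M (ModuleCat.of A (CharacterModule N)) i →ₗ[A]
        Abelian.Ext M (ModuleCat.of A (CharacterModule (QuotSMulTop y N))) (i + 1) :=
      Ext.postcompOfLinear hS.extClass A M rfl
    have hδ : Function.Surjective δ := fun x =>
      Ext.covariant_sequence_exact₁ M hS x (Subsingleton.elim (h := this) _ _) rfl
    rw [ExtFull, Ideal.ofList_cons_smul, eq_top_iff]
    intro e _
    have he : δ e ∈ (Ideal.ofList ys • (⊤ : Submodule A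
        (Abelian.Ext M (ModuleCat.of A (CharacterModule N)) i))).map δ := by
      rw [Submodule.map_smul'', Submodule.map_top, LinearMap.range_eq_top.2 hδ]
      exact (eq_top_iff.1 hfull) trivial
    obtain ⟨e', he', heq⟩ := he
    obtain ⟨z, hz⟩ := Ext.covariant_sequence_exact₃ M hS (e - e') rfl
      (show δ (e - e') = 0 by rw [map_sub, heq, sub_self])
    have hz' : e - e' = y • z := by
      rw [← hz, Ext.smul_eq_comp_mk₀]
      rfl
    rw [← sub_add_cancel e e', hz']
    exact Submodule.add_mem_sup (Submodule.smul_mem_pointwise_smul _ _ _ trivial) he'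

end Codepth

section Tor

open scoped TensorProduct

variable {A : Type u} [CommRing A]

/-- The augmentation map of a projective resolution. -/
def augmentation {Z : ModuleCat.{u} A} (P : ProjectiveResolution Z) : P.complex.X 0 ⟶ Z :=
  P.π.f 0

lemma d_comp_augmentation {Z : ModuleCat.{u} A} (P : ProjectiveResolution Z) :
    P.complex.d 1 0 ≫ augmentation P = 0 :=
  P.complex_d_comp_π_f_zero

lemma augmentation_surjective {Z : ModuleCat.{u} A} (P : ProjectiveResolution Z) :
    Function.Surjective (augmentation P).hom :=
  (ModuleCat.epi_iff_surjective _).1 (inferInstanceAs (Epi (P.π.f 0)))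

lemma exact_d_augmentation {Z : ModuleCat.{u} A} (P : ProjectiveResolution Z) :
    Function.Exact (P.complex.d 1 0).hom (augmentation P).hom :=
  (ShortComplex.ShortExact.moduleCat_exact_iff_function_exact _).1 P.exact₀

/-- The projective resolution obtained by splicing a projective resolution of `X₁` with a short
exact sequence `0 → X₁ → X₂ → X₃ → 0` whose middle term is projective. -/
def spliceResolution {S : ShortComplex (ModuleCat.{u} A)} (hS : S.ShortExact) [Projective S.X₂]
    (P : ProjectiveResolution S.X₁) : ProjectiveResolution S.X₃ where
  complex := P.complex.augment (augmentation P ≫ S.f) (by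
    rw [← Category.assoc, d_comp_augmentation, Limits.zero_comp])
  projective := by
    rintro (_ | n)
    · exact inferInstanceAs (Projective S.X₂)
    · exact P.projective n
  π := (ChainComplex.toSingle₀Equiv _ _).symm ⟨S.g, by
    change (augmentation P ≫ S.f) ≫ S.g = 0
    rw [Category.assoc, S.zero, Limits.comp_zero]⟩
  quasiIso := ⟨fun n => by
    rcases n with _ | n
    · rw [ChainComplex.quasiIsoAt₀_iff, ShortComplex.quasiIso_iff_of_zeros']
      · refine (ShortComplex.exact_and_epi_g_iff_of_iso (S₂ := ShortComplex.mk
          (augmentation P ≫ S.f) S.g (by rw [Category.assoc, S.zero, Limits.comp_zero])) ?_).2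
          ⟨?_, hS.epi_g⟩
        · exact ShortComplex.isoMk (Iso.refl _) (Iso.refl _) (Iso.refl _)
            ((Category.id_comp _).trans (Category.comp_id _).symm)
            ((Category.id_comp _).trans (Category.comp_id _).symm)
        · rw [ShortComplex.ShortExact.moduleCat_exact_iff_function_exact]
          have h := (ShortComplex.ShortExact.moduleCat_exact_iff_function_exact S).1 hS.exact
          intro x
          refine (h x).trans ⟨?_, ?_⟩
          · rintro ⟨y, rfl⟩
            obtain ⟨z, rfl⟩ := augmentation_surjective P y
            exact ⟨z, rfl⟩
          · rintro ⟨z, rfl⟩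
            exact ⟨_, rfl⟩
      all_goals rfl
    · rw [quasiIsoAt_iff_exactAt']
      · rcases n with _ | n
        · rw [HomologicalComplex.exactAt_iff' _ 2 1 0 (by simp) (by simp),
            ShortComplex.ShortExact.moduleCat_exact_iff_function_exact]
          have hf : Function.Injective S.f.hom :=
            (ModuleCat.mono_iff_injective _).1 hS.mono_f
          intro x
          refine Iff.trans ?_ (exact_d_augmentation P x)
          exact map_eq_zero_iff S.f.hom hf
        · rw [HomologicalComplex.exactAt_iff' _ (n + 3) (n + 2) (n + 1) (by simp) (by simp)]
          exact P.exact_succ n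
      · apply ChainComplex.exactAt_succ_single_obj⟩

variable {S : ShortComplex (ModuleCat.{u} A)}

/-- Dimension shifting for `Tor`. -/
def torShiftIso (hS : S.ShortExact) [Projective S.X₂] (N : ModuleCat.{u} A) (i : ℕ) :
    TorMod A (i + 2) S.X₃ N ≅ TorMod A (i + 1) S.X₁ N :=
  let F := (MonoidalCategory.tensoringRight (ModuleCat.{u} A)).obj N
  let P := ProjectiveResolution.of S.X₁
  (spliceResolution hS P).isoLeftDerivedObj F (i + 2) ≪≫
    HomologicalComplex.homologyIsoSc' _ (i + 3) (i + 2) (i + 1) (by simp) (by simp) ≪≫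
    (HomologicalComplex.homologyIsoSc' ((F.mapHomologicalComplex _).obj P.complex)
      (i + 2) (i + 1) i (by simp) (by simp)).symm ≪≫
    (P.isoLeftDerivedObj F (i + 1)).symm

lemma nonempty_quotient_equiv_ker_rTensor {P₁ P₀ K F N : Type u} [AddCommGroup P₁]
    [AddCommGroup P₀] [AddCommGroup K] [AddCommGroup F] [AddCommGroup N] [Module A P₁]
    [Module A P₀] [Module A K] [Module A F] [Module A N] (d : P₁ →ₗ[A] P₀) (π : P₀ →ₗ[A] K)
    (f : K →ₗ[A] F) (hπ : Function.Surjective π) (h : Function.Exact d π)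
    (c : TensorProduct A P₁ N →ₗ[A] LinearMap.ker ((f ∘ₗ π).rTensor N))
    (hc : ∀ x, (c x : TensorProduct A P₀ N) = d.rTensor N x) :
    Nonempty ((LinearMap.ker ((f ∘ₗ π).rTensor N) ⧸ LinearMap.range c) ≃ₗ[A]
      LinearMap.ker (f.rTensor N)) := by
  have hex := rTensor_exact N h hπ
  have hsurj := LinearMap.rTensor_surjective N hπ
  let τ : LinearMap.ker ((f ∘ₗ π).rTensor N) →ₗ[A] LinearMap.ker (f.rTensor N) :=
    (π.rTensor N).restrict (fun x hx => by
      rw [LinearMap.mem_ker] at hx ⊢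
      rwa [LinearMap.rTensor_comp] at hx)
  have hτ : Function.Surjective τ := by
    rintro ⟨y, hy⟩
    obtain ⟨x, rfl⟩ := hsurj y
    refine ⟨⟨x, ?_⟩, rfl⟩
    rw [LinearMap.mem_ker] at hy ⊢
    rwa [LinearMap.rTensor_comp]
  refine ⟨(Submodule.quotEquivOfEq _ _ ?_).trans (τ.quotKerEquivOfSurjective hτ)⟩
  ext ⟨x, hx⟩
  rw [LinearMap.mem_range, LinearMap.mem_ker, ← Subtype.coe_inj]
  refine Iff.trans ?_ (hex x).symm
  refine exists_congr fun y => ?_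
  rw [← Subtype.coe_inj, hc]

lemma nonempty_torOne_equiv (hS : S.ShortExact) [Projective S.X₂] (N : ModuleCat.{u} A) :
    Nonempty (TorMod A 1 S.X₃ N ≃ₗ[A] LinearMap.ker (S.f.hom.rTensor N)) := by
  let G := (MonoidalCategory.tensoringRight (ModuleCat.{u} A)).obj N
  let P := ProjectiveResolution.of S.X₁
  let K := (G.mapHomologicalComplex _).obj (spliceResolution hS P).complex
  let e := ((spliceResolution hS P).isoLeftDerivedObj G 1 ≪≫
    HomologicalComplex.homologyIsoSc' K 2 1 0 (by simp) (by simp) ≪≫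
    (K.sc' 2 1 0).moduleCatHomologyIso).toLinearEquiv
  obtain ⟨e'⟩ := nonempty_quotient_equiv_ker_rTensor (N := N) (P.complex.d 1 0).hom
    (augmentation P).hom S.f.hom (augmentation_surjective P) (exact_d_augmentation P)
    (K.sc' 2 1 0).moduleCatToCycles (fun _ => rfl)
  exact ⟨e.trans e'⟩

lemma finite_tor [IsNoetherianRing A] (i : ℕ) (M N : ModuleCat.{u} A) [Module.Finite A M]
    [Module.Finite A N] : Module.Finite A (TorMod A (i + 1) M N) := by
  induction i generalizing M with
  | zero =>
    obtain ⟨n, f, hf⟩ := Module.Finite.exists_fin' A M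
    have hS := LinearMap.shortExact_shortComplexKer hf
    have : Module.Finite A f.shortComplexKer.X₂ := inferInstanceAs (Module.Finite A (Fin n → A))
    have : Module.Finite A f.shortComplexKer.X₁ :=
      inferInstanceAs (Module.Finite A (LinearMap.ker f))
    have : Projective f.shortComplexKer.X₂ := ModuleCat.projective_of_free (Pi.basisFun A (Fin n))
    obtain ⟨e⟩ := nonempty_torOne_equiv hS N
    exact Module.Finite.equiv e.symm
  | succ i ih =>
    obtain ⟨n, f, hf⟩ := Module.Finite.exists_fin' A M
    have hS := LinearMap.shortExact_shortComplexKer hf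
    have : Module.Finite A f.shortComplexKer.X₁ :=
      inferInstanceAs (Module.Finite A (LinearMap.ker f))
    have : Projective f.shortComplexKer.X₂ := ModuleCat.projective_of_free (Pi.basisFun A (Fin n))
    have := ih f.shortComplexKer.X₁
    exact Module.Finite.equiv (torShiftIso hS N i).toLinearEquiv.symm

lemma extFull_one_bot_of_rTensor_injective (hS : S.ShortExact) [Projective S.X₂] (C : Type u)
    [AddCommGroup C] [Module A C] (h : Function.Injective (S.f.hom.rTensor C)) :
    ExtFull ⊥ 1 S.X₃ (ModuleCat.of A (CharacterModule C)) := by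
  rw [extFull_one_iff hS]
  intro φ
  obtain ⟨ψ, hψ⟩ := rTensor_injective_iff_lcomp_surjective.1 h φ
  refine ⟨ψ, ?_⟩
  have h0 : φ - ψ ∘ₗ S.f.hom = 0 := sub_eq_zero.2 hψ.symm
  rw [h0]
  exact Submodule.zero_mem _

lemma characterModule_apply_eq_zero {C : Type*} [AddCommGroup C] [Module A C] {I : Ideal A}
    {χ : CharacterModule C} (hχ : χ ∈ I • (⊤ : Submodule A (CharacterModule C))) {t : C}
    (ht : ∀ r ∈ I, r • t = 0) : χ t = 0 := by
  induction hχ using Submodule.smul_induction_on' with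
  | smul r hr c _ => rw [CharacterModule.smul_apply, ht r hr, map_zero]
  | add c _ c' _ h h' => exact (congrArg₂ (· + ·) h h').trans (add_zero 0)

lemma not_extFull_one_of_rTensor_eq_zero (hS : S.ShortExact) [Projective S.X₂] (C : Type u)
    [AddCommGroup C] [Module A C] (I : Ideal A) (t : TensorProduct A S.X₁ C) (ht : t ≠ 0)
    (h0 : S.f.hom.rTensor C t = 0) (hI : ∀ r ∈ I, r • t = 0) :
    ¬ ExtFull I 1 S.X₃ (ModuleCat.of A (CharacterModule C)) := by
  rw [extFull_one_iff hS]
  intro h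
  obtain ⟨χ, hχ⟩ := CharacterModule.exists_character_apply_ne_zero_of_ne_zero ht
  obtain ⟨ψ, hψ⟩ := h (CharacterModule.curry χ)
  have h1 := Submodule.mem_map_of_mem (f := (CharacterModule.homEquiv (R := A)).toLinearMap) hψ
  rw [Submodule.map_smul''] at h1
  have h2 := characterModule_apply_eq_zero (Submodule.smul_mono le_rfl le_top h1) hI
  rw [map_sub] at h2
  have h3 : (CharacterModule.homEquiv (R := A)).toLinearMap (CharacterModule.curry χ) = χ :=
    CharacterModule.homEquiv.apply_symm_apply χ
  have h4 : (CharacterModule.homEquiv (R := A)).toLinearMap (ψ ∘ₗ S.f.hom) =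
      CharacterModule.dual (S.f.hom.rTensor C) (CharacterModule.homEquiv (R := A) ψ) :=
    CharacterModule.homEquiv.symm.injective rfl
  rw [h3, h4] at h2
  have h5 : χ t - CharacterModule.homEquiv (R := A) ψ (S.f.hom.rTensor C t) = 0 := h2
  rw [h0, map_zero, sub_zero] at h5
  exact hχ h5

lemma leftComm_lTensor_rTensor {K F : Type u} [AddCommGroup K] [AddCommGroup F] [Module A K]
    [Module A F] (T N : Type u) [AddCommGroup T] [AddCommGroup N] [Module A T] [Module A N]
    (f : K →ₗ[A] F) : f.rTensor (TensorProduct A T N) ∘ₗ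
        (TensorProduct.leftComm A T K N).toLinearMap =
      (TensorProduct.leftComm A T F N).toLinearMap ∘ₗ (f.rTensor N).lTensor T := by
  ext
  simp

variable (T : Type u) [CommRing T] [Algebra A T]

lemma extFull_bot_of_subsingleton_tor [Module.Flat A T] (i : ℕ) (M N : ModuleCat.{u} A)
    (h : Subsingleton (TorMod A (i + 1) M N)) :
    ExtFull ⊥ (i + 1) M (ModuleCat.of A (CharacterModule (TensorProduct A T N))) := by
  have hS := M.shortExact_projectiveShortComplex
  have : Projective M.projectiveShortComplex.X₂ :=
    ModuleCat.projective_of_free (Module.Free.chooseBasis A M.projectiveShortComplex.X₂)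
  induction i generalizing M with
  | zero =>
    obtain ⟨e⟩ := nonempty_torOne_equiv hS N
    refine extFull_one_bot_of_rTensor_injective hS _ ?_
    have hinj : Function.Injective (M.projectiveShortComplex.f.hom.rTensor N) := by
      rw [← LinearMap.ker_eq_bot, ← Submodule.subsingleton_iff_eq_bot]
      exact e.symm.toEquiv.subsingleton
    have h1 := Module.Flat.lTensor_preserves_injective_linearMap (M := T) _ hinj
    have h2 := leftComm_lTensor_rTensor T N M.projectiveShortComplex.f.hom
    have h3 : Function.Injective (M.projectiveShortComplex.f.hom.rTensor (TensorProduct A T N) ∘ₗ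
        (TensorProduct.leftComm A T M.projectiveShortComplex.X₁ N).toLinearMap) := by
      rw [h2]
      exact (TensorProduct.leftComm A T M.projectiveShortComplex.X₂ N).injective.comp h1
    intro x y hxy
    obtain ⟨x, rfl⟩ := (TensorProduct.leftComm A T M.projectiveShortComplex.X₁ N).surjective x
    obtain ⟨y, rfl⟩ := (TensorProduct.leftComm A T M.projectiveShortComplex.X₁ N).surjective y
    rw [h3 hxy]
  | succ i ih =>
    let e : TorMod A (i + 2) M N ≃ₗ[A] TorMod A (i + 1) M.projectiveShortComplex.X₁ N :=
      (torShiftIso hS N i).toLinearEquiv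
    have h1 : Subsingleton (TorMod A (i + 1) M.projectiveShortComplex.X₁ N) :=
      e.symm.toEquiv.subsingleton
    rw [extFull_shift hS _ (Nat.succ_pos i)]
    exact ih _ h1 (ModuleCat.shortExact_projectiveShortComplex _) (ModuleCat.projective_of_free
      (Module.Free.chooseBasis A (ModuleCat.projectiveShortComplex _).X₂))

lemma not_extFull_of_smul_tor_eq_zero [Module.FaithfullyFlat A T] (I : Ideal A) (i : ℕ)
    (M N : ModuleCat.{u} A) (t : TorMod A (i + 1) M N) (ht : t ≠ 0) (hI : ∀ r ∈ I, r • t = 0) :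
    ¬ ExtFull I (i + 1) M (ModuleCat.of A (CharacterModule (TensorProduct A T N))) := by
  have hS := M.shortExact_projectiveShortComplex
  have : Projective M.projectiveShortComplex.X₂ :=
    ModuleCat.projective_of_free (Module.Free.chooseBasis A M.projectiveShortComplex.X₂)
  induction i generalizing M with
  | zero =>
    obtain ⟨e⟩ := nonempty_torOne_equiv hS N
    have ht' : (e t : TensorProduct A M.projectiveShortComplex.X₁ N) ≠ 0 := by
      rwa [Ne, ZeroMemClass.coe_eq_zero, LinearEquiv.map_eq_zero_iff]
    refine not_extFull_one_of_rTensor_eq_zero hS _ I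
      (TensorProduct.leftComm A T M.projectiveShortComplex.X₁ N ((1 : T) ⊗ₜ (e t).1)) ?_ ?_ ?_
    · rw [Ne, LinearEquiv.map_eq_zero_iff]
      exact fun h => ht' ((Module.FaithfullyFlat.one_tmul_eq_zero_iff _ _ _).1 h)
    · have := LinearMap.congr_fun (leftComm_lTensor_rTensor T N
        M.projectiveShortComplex.f.hom) ((1 : T) ⊗ₜ (e t).1)
      refine this.trans ?_
      rw [LinearMap.comp_apply, LinearMap.lTensor_tmul, LinearMap.mem_ker.1 (e t).2,
        TensorProduct.tmul_zero, map_zero]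
    · intro r hr
      rw [← map_smul, ← TensorProduct.tmul_smul, ← Submodule.coe_smul, ← map_smul, hI r hr]
      simp
  | succ i ih =>
    rw [extFull_shift hS _ (Nat.succ_pos i)]
    refine ih _ ((torShiftIso hS N i).toLinearEquiv t) ?_ ?_
      (ModuleCat.shortExact_projectiveShortComplex _) (ModuleCat.projective_of_free
      (Module.Free.chooseBasis A (ModuleCat.projectiveShortComplex _).X₂))
    · rwa [Ne, LinearEquiv.map_eq_zero_iff]
    · intro r hr
      rw [← map_smul, hI r hr, map_zero]

end Tor

section Depth

open IsLocalRing RingTheory.Sequence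

variable {A : Type u} [CommRing A] [IsLocalRing A]

lemma bddAbove_length_of_isRegular [IsNoetherianRing A] (M : ModuleCat.{u} A) [Module.Finite A M]
    [Nontrivial M] : BddAbove {n | ∃ rs : List A, rs.length = n ∧
      (∀ r ∈ rs, r ∈ maximalIdeal A) ∧ IsRegular M rs} := by
  obtain ⟨d, hd⟩ := ENat.ne_top_iff_exists.1 (WithBot.coe_eq_top.not.1
    ((WithBot.coe_unbot (ringKrullDim A) ringKrullDim_ne_bot).trans_ne ringKrullDim_ne_top))
  refine ⟨d, ?_⟩
  rintro n ⟨rs, rfl, -, h⟩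
  have h1 := Module.supportDim_add_length_eq_supportDim_of_isRegular rs h
  have : Nontrivial (M ⧸ Ideal.ofList rs • (⊤ : Submodule A M)) :=
    Submodule.Quotient.nontrivial_iff.2 h.top_ne_smul.symm
  have h2 : 0 ≤ Module.supportDim A (M ⧸ Ideal.ofList rs • (⊤ : Submodule A M)) := by
    have := Module.supportDim_ne_bot_of_nontrivial A (M ⧸ Ideal.ofList rs • (⊤ : Submodule A M))
    exact WithBot.coe_unbot _ this ▸ WithBot.coe_le_coe.2 bot_le
  have h3 := Module.supportDim_le_ringKrullDim A M
  have h4 : (rs.length : WithBot ℕ∞) ≤ (d : ℕ∞) := by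
    rw [hd, WithBot.coe_unbot]
    refine le_trans ?_ (h1.le.trans h3)
    exact le_add_of_nonneg_left h2
  exact_mod_cast h4

lemma exists_smul_eq_zero_of_depth_eq_zero [IsNoetherianRing A] (M : ModuleCat.{u} A)
    [Module.Finite A M] [Nontrivial M] (h : depth A M = 0) :
    ∃ t : M, t ≠ 0 ∧ ∀ r ∈ maximalIdeal A, r • t = 0 := by
  by_contra! hM
  have h1 : Subsingleton ((A ⧸ maximalIdeal A) →ₗ[A] M) := by
    refine subsingleton_of_forall_eq 0 fun f => ?_
    have h2 : f (Ideal.Quotient.mk _ 1) = 0 := by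
      by_contra h0
      obtain ⟨r, hr, hrt⟩ := hM _ h0
      refine hrt ?_
      have h3 : r • Ideal.Quotient.mk (maximalIdeal A) 1 = 0 := by
        rw [Algebra.smul_def, map_one, mul_one]
        exact Ideal.Quotient.eq_zero_iff_mem.2 hr
      rw [← map_smul, h3, map_zero]
    refine Submodule.linearMap_qext _ (LinearMap.ext_ring ?_)
    exact h2
  obtain ⟨r, hr, hreg⟩ := IsSMulRegular.subsingleton_linearMap_iff.1 h1
  rw [Ideal.annihilator_quotient] at hr
  have h3 : ∀ x ∈ [r], x ∈ maximalIdeal A := by simpa using hr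
  have h4 : 1 ≤ depth A M := le_csSup (bddAbove_length_of_isRegular M) ⟨[r], rfl, h3,
    (IsLocalRing.isRegular_iff_isWeaklyRegular_of_subset_maximalIdeal h3).2
      ((isWeaklyRegular_singleton_iff M r).2 hreg)⟩
  omega

lemma exists_isWeaklyRegular_of_le_depth (M : ModuleCat.{u} A) {g : ℕ} (hg : 0 < g)
    (h : g ≤ depth A M) : ∃ ys : List A, ys.length = g ∧ (∀ y ∈ ys, y ∈ maximalIdeal A) ∧
      IsWeaklyRegular M ys := by
  let L : Set ℕ := {n | ∃ rs : List A, rs.length = n ∧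
    (∀ r ∈ rs, r ∈ maximalIdeal A) ∧ IsRegular M rs}
  have hd : sSup L = depth A M := rfl
  have hne : sSup L ≠ 0 := by omega
  have hL : L.Nonempty := by
    by_contra h0
    rw [Set.not_nonempty_iff_eq_empty.1 h0] at hne
    exact hne csSup_empty
  obtain ⟨rs, hlen, hm, hreg⟩ := Nat.sSup_mem hL (by
    by_contra hb
    exact hne (Nat.sSup_of_not_bddAbove hb))
  refine ⟨rs.take g, ?_, fun y hy => hm y (List.mem_of_mem_take hy), ?_⟩
  · rw [List.length_take, hlen]
    exact min_eq_left h
  · have := hreg.toIsWeaklyRegular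
    rw [← List.take_append_drop g rs, isWeaklyRegular_append_iff] at this
    exact this.1

end Depth

section ProjDim

open RingTheory.Sequence
open scoped Pointwise

variable {A : Type u} [CommRing A]

lemma ProjDimLE.subsingleton_ext {k : ℕ} {M : ModuleCat.{u} A} (h : ProjDimLE A k M) (j : ℕ)
    (hj : k < j) (X : ModuleCat.{u} A) : Subsingleton (Abelian.Ext M X j) := by
  induction k generalizing M j with
  | zero =>
    obtain ⟨j, rfl⟩ := Nat.exists_eq_succ_of_ne_zero hj.ne'
    have : Projective M := h
    exact subsingleton_of_forall_eq 0 Ext.eq_zero_of_projective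
  | succ k ih =>
    obtain ⟨K, F, f, g, w, hF, hS, hK⟩ := h
    obtain ⟨j, rfl⟩ := Nat.exists_eq_succ_of_ne_zero (Nat.ne_zero_of_lt hj)
    have : Projective (ShortComplex.mk f g w).X₂ :=
      ModuleCat.projective_of_free (Module.Free.chooseBasis A F)
    have := ih hK j (by omega)
    exact (extShiftEquiv hS X j (by omega)).symm.toEquiv.subsingleton

lemma exists_free_shortExact (M : ModuleCat.{u} A) :
    ∃ (K F : ModuleCat.{u} A) (f : K ⟶ F) (g : F ⟶ M) (w : f ≫ g = 0),
      Module.Free A F ∧ (ShortComplex.mk f g w).ShortExact := by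
  let q := Finsupp.linearCombination A (id : M → M)
  refine ⟨ModuleCat.of A (LinearMap.ker q), ModuleCat.of A (M →₀ A),
    ModuleCat.ofHom (LinearMap.ker q).subtype, ModuleCat.ofHom q, ?_, inferInstance, ?_⟩
  · ext x
    exact x.2
  · apply ModuleCat.shortComplex_shortExact
    · intro x
      exact ⟨fun h => ⟨⟨x, h⟩, rfl⟩, fun ⟨y, hy⟩ => hy ▸ y.2⟩
    · exact Subtype.val_injective
    · exact Finsupp.linearCombination_id_surjective A M

lemma projDimLE_of_hasProjectiveDimensionLT (n : ℕ) (M : ModuleCat.{u} A)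
    (h : HasProjectiveDimensionLT M (n + 1)) : ProjDimLE A n M := by
  induction n generalizing M with
  | zero => exact (projective_iff_hasProjectiveDimensionLT_one).2 h
  | succ n ih =>
    obtain ⟨K, F, f, g, w, hF, hS⟩ := exists_free_shortExact M
    have : Projective (ShortComplex.mk f g w).X₂ :=
      ModuleCat.projective_of_free (Module.Free.chooseBasis A F)
    exact ⟨K, F, f, g, w, hF, hS, ih K ((hS.hasProjectiveDimensionLT_X₃_iff n this).1 h)⟩

lemma hasProjectiveDimensionLT_quotient_ofList (rs : List A) (M : ModuleCat.{u} A)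
    (hreg : IsWeaklyRegular M rs) (m : ℕ) (h : HasProjectiveDimensionLT M m) :
    HasProjectiveDimensionLT
      (ModuleCat.of A (M ⧸ Ideal.ofList rs • (⊤ : Submodule A M))) (m + rs.length) := by
  induction rs generalizing M m with
  | nil =>
    exact hasProjectiveDimensionLT_of_iso (Submodule.quotEquivOfEqBot
      (Ideal.ofList [] • (⊤ : Submodule A M)) (by simp)).symm.toModuleIso m
  | cons x rs ih =>
    obtain ⟨hx, hrs⟩ := (isWeaklyRegular_cons_iff M x rs).1 hreg
    have h₁ := hx.smulShortComplex_shortExact.hasProjectiveDimensionLT_X₃ m h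
      (hasProjectiveDimensionLT_of_ge M m (m + 1) (Nat.le_succ m))
    have h₂ := ih (ModuleCat.of A (QuotSMulTop x M)) hrs (m + 1) h₁
    rw [List.length_cons, ← Nat.add_assoc, Nat.add_right_comm]
    exact hasProjectiveDimensionLT_of_iso
      (Submodule.quotOfListConsSMulTopEquivQuotSMulTopInner M x rs).symm.toModuleIso _

/-- A quotient by a weakly regular sequence has projective dimension at most its length. -/
lemma projDimLE_of_ker_eq_ofList {B : Type u} [AddCommGroup B] [Module A B] (f : A →ₗ[A] B)
    (hf : Function.Surjective f) (rs : List A) (hreg : IsWeaklyRegular A rs)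
    (hker : LinearMap.ker f = Ideal.ofList rs) : ProjDimLE A rs.length (ModuleCat.of A B) := by
  refine projDimLE_of_hasProjectiveDimensionLT _ _ ?_
  have h : HasProjectiveDimensionLT (ModuleCat.of A A) 1 :=
    (projective_iff_hasProjectiveDimensionLT_one).1
      (ModuleCat.projective_of_free (Module.Free.chooseBasis A A))
  have h' := hasProjectiveDimensionLT_quotient_ofList rs (ModuleCat.of A A) hreg 1 h
  rw [Nat.add_comm] at h'
  have e : (A ⧸ Ideal.ofList rs • (⊤ : Submodule A A)) ≃ₗ[A] B :=
    (Submodule.quotEquivOfEq _ _ (by rw [hker, smul_eq_mul, Ideal.mul_top])).trans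
      (f.quotKerEquivOfSurjective hf)
  exact hasProjectiveDimensionLT_of_iso e.toModuleIso _

lemma projDim_le_of_projDimLE {k : ℕ} {M : ModuleCat.{u} A} (h : ProjDimLE A k M) :
    projDim A M ≤ k :=
  sInf_le ⟨k, rfl, h⟩

lemma exists_projDimLE_of_projDim_ne_top {M : ModuleCat.{u} A} (h : projDim A M ≠ ⊤) :
    ∃ k : ℕ, projDim A M = k ∧ ProjDimLE A k M := by
  refine csInf_mem (s := {d : ℕ∞ | ∃ n : ℕ, d = n ∧ ProjDimLE A n M}) ?_
  by_contra h0
  refine h ?_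
  rw [projDim, Set.not_nonempty_iff_eq_empty.1 h0, sInf_empty]

end ProjDim

section QuasiDeformation

open TensorProduct RingTheory.Sequence

/-- Let `T` be the quotient of `Q` by a weakly regular sequence of length `n`, and `L` a `T`-module
of projective dimension at most `g + n` over `Q`. If `Ext_T^i(L, -)` of the character module of `C`
vanishes for `i > p` and `C` has a weakly regular sequence `ys` of length greater than `g - p`, then
`Ext_T^p(L, -)` of this character module is equal to its multiple by `ys`. -/
lemma extFull_characterModule_of_surjective {Q T : Type u} [CommRing Q] [CommRing T] [Algebra Q T]
    (hs : Function.Surjective (algebraMap Q T)) (rs : List Q)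
    (hker : RingHom.ker (algebraMap Q T) = Ideal.ofList rs) (hreg : IsWeaklyRegular Q rs)
    (L C : Type u) [AddCommGroup L] [Module T L]
    [AddCommGroup C] [Module T C] {g p : ℕ} (hp : 0 < p)
    (hpd : letI : Module Q L := Module.compHom _ (algebraMap Q T)
      ∀ j, g + rs.length < j → ∀ X : ModuleCat.{u} Q,
        Subsingleton (Abelian.Ext (ModuleCat.of Q L) X j))
    (hv : ∀ i, p < i →
      Subsingleton (Abelian.Ext (ModuleCat.of T L) (ModuleCat.of T (CharacterModule C)) i))
    (ys : List T) (hys : IsWeaklyRegular C ys) (hg : g < p + ys.length) :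
    ExtFull (Ideal.ofList ys) p (ModuleCat.of T L) (ModuleCat.of T (CharacterModule C)) := by
  let : Module Q L := Module.compHom _ (algebraMap Q T)
  have : IsScalarTower Q T L := IsScalarTower.of_algebraMap_smul fun _ _ => rfl
  let : Module Q C := Module.compHom _ (algebraMap Q T)
  have hC (a : Q) (c : C) : algebraMap Q T a • c = a • c := rfl
  have : IsScalarTower Q T C := IsScalarTower.of_algebraMap_smul hC
  have : IsScalarTower Q T (CharacterModule C) := IsScalarTower.of_algebraMap_smul
    fun a χ => CharacterModule.ext _ fun c => congrArg χ (hC a c)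
  obtain ⟨h₁, h₂⟩ := ext_completeIntersection rs.length hs rs rfl hker hreg L
    (CharacterModule C) hp hv
  obtain ⟨zs, rfl⟩ := (List.map_surjective_iff.2 hs) ys
  rw [List.length_map] at hg
  have := h₂ _ (extFull_characterModule_of_isWeaklyRegular (ModuleCat.of Q L) zs (p + rs.length) C
    ((isWeaklyRegular_map_algebraMap_iff T C zs).1 hys) h₁ fun j hj => hpd j (by omega))
  rwa [Ideal.map_ofList] at this

/-- Let `A → T ← Q` be a quasi-deformation along which `M` has projective dimension at most
`g + n` over `Q`, where `n` is the codimension of `T` in `Q`. If `Tor_i(M, N)` vanishes for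
`i > p + 1` and `N` has a weakly regular sequence `ys` of length greater than `g - (p + 1)`, then
`Ext^(p + 1)(M, -)` of the character module of `T ⊗ N` is equal to its multiple by `ys`. -/
lemma extFull_characterModule_of_subsingleton_tor {A T Q : Type u} [CommRing A] [CommRing T]
    [CommRing Q] [Algebra A T] [Algebra Q T] [Module.Flat A T]
    (hs : Function.Surjective (algebraMap Q T)) (rs : List Q)
    (hker : RingHom.ker (algebraMap Q T) = Ideal.ofList rs) (hreg : IsWeaklyRegular Q rs)
    (M N : ModuleCat.{u} A) (g p : ℕ)
    (hpd : letI : Module Q (T ⊗[A] M) := Module.compHom _ (algebraMap Q T)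
      ∀ j, g + rs.length < j → ∀ X : ModuleCat.{u} Q,
        Subsingleton (Abelian.Ext (ModuleCat.of Q (T ⊗[A] M)) X j))
    (hv : ∀ i, p + 1 < i → Subsingleton (TorMod A i M N))
    (ys : List A) (hys : IsWeaklyRegular N ys) (hg : g < p + 1 + ys.length) :
    ExtFull (Ideal.ofList ys) (p + 1) M (ModuleCat.of A (CharacterModule (T ⊗[A] N))) := by
  have : IsScalarTower A T (CharacterModule (T ⊗[A] N)) := IsScalarTower.of_algebraMap_smul
    fun a χ => CharacterModule.ext _ fun t => congrArg χ (algebraMap_smul T a t)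
  have hT (i : ℕ) (hi : p + 1 < i) : Subsingleton (Abelian.Ext (ModuleCat.of T (T ⊗[A] M))
      (ModuleCat.of T (CharacterModule (T ⊗[A] N))) i) := by
    obtain ⟨i, rfl⟩ := Nat.exists_eq_succ_of_ne_zero (Nat.ne_zero_of_lt hi)
    have h := extFull_bot_of_subsingleton_tor T i M N (hv _ hi)
    rwa [extFull_baseChange_of_flat T _ _ i.succ_pos, Ideal.map_bot, extFull_bot] at h
  have hysT : IsWeaklyRegular (T ⊗[A] N) (ys.map (algebraMap A T)) :=
    IsWeaklyRegular.of_flat_of_isBaseChange (TensorProduct.isBaseChange A N T) hys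
  rw [extFull_baseChange_of_flat T _ _ p.succ_pos, Ideal.map_ofList]
  exact extFull_characterModule_of_surjective hs rs hker hreg (T ⊗[A] M) (T ⊗[A] N) p.succ_pos
    hpd hT _ hysT (by rwa [List.length_map])

/-- A module of finite complete intersection dimension `g` has a quasi-deformation witnessing
this. -/
lemma exists_quasiDeformation_of_cIdim_eq {A : Type u} [CommRing A] [IsLocalRing A]
    (M : ModuleCat.{u} A) (g : ℕ) (hg : CIdim A M = g) :
    ∃ D : QuasiDeformation A,
      letI := D.φ.toAlgebra
      letI : Module D.Q (D.R' ⊗[A] M) := Module.compHom _ D.ψ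
      ∃ rs : List D.Q, IsWeaklyRegular D.Q rs ∧ RingHom.ker D.ψ = Ideal.ofList rs ∧
        ∀ j, g + rs.length < j → ∀ X : ModuleCat.{u} D.Q,
          Subsingleton (Abelian.Ext (ModuleCat.of D.Q (D.R' ⊗[A] M)) X j) := by
  have hne : CIdim A M ≠ ⊤ := by simp [hg]
  have hmem := csInf_mem (Set.nonempty_iff_ne_empty.2 fun h =>
    hne ((congrArg sInf h).trans sInf_empty))
  obtain ⟨D, hD⟩ := hmem
  refine ⟨D, ?_⟩
  let : Algebra A D.R' := D.φ.toAlgebra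
  let : Module D.Q D.R' := Module.compHom _ D.ψ
  let : Module D.Q (D.R' ⊗[A] M) := Module.compHom _ D.ψ
  obtain ⟨rs, hreg, hker⟩ := D.ker_reg
  refine ⟨rs, hreg.toIsWeaklyRegular, hker, ?_⟩
  replace hD : (g : ℕ∞) = projDim D.Q (ModuleCat.of D.Q (D.R' ⊗[A] M)) -
    projDim D.Q (ModuleCat.of D.Q D.R') := hg.symm.trans hD
  let f : D.Q →ₗ[D.Q] D.R' :=
    { toFun := D.ψ
      map_add' := map_add D.ψ
      map_smul' := map_mul D.ψ }
  have hf : LinearMap.ker f = Ideal.ofList rs := by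
    ext x
    exact SetLike.ext_iff.1 hker x
  have h₁ := projDim_le_of_projDimLE
    (projDimLE_of_ker_eq_ofList f D.surj rs hreg.toIsWeaklyRegular hf)
  have h₂ : projDim D.Q (ModuleCat.of D.Q (D.R' ⊗[A] M)) ≤ ((g + rs.length : ℕ) : ℕ∞) := by
    rw [Nat.cast_add, hD]
    exact le_tsub_add.trans (add_le_add_right h₁ _)
  obtain ⟨k, hk, hk'⟩ := exists_projDimLE_of_projDim_ne_top
    (h₂.trans_lt (ENat.natCast_lt_top _)).ne
  rw [hk, Nat.cast_le] at h₂
  exact fun j hj => hk'.subsingleton_ext j (by omega)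

end QuasiDeformation

theorem stmt9 (R : Type u) [CommRing R] [IsLocalRing R] [IsNoetherianRing R]
    (M N : ModuleCat.{u} R) (hM : Module.Finite R M) (hN : Module.Finite R N)
    (g : ℕ) (hg : CIdim R M = (g : ℕ∞))
    (hdepth : g ≤ depth R N)
    (r : ℕ) (hr : 0 < r) (hrg : r ≤ g)
    (hiv : ∀ i : ℕ, r ≤ i → i ≤ g →
      depth R (TorMod R i M N) = 0 ∨ Subsingleton (TorMod R i M N)) :
    (∃ n : ℕ, ∀ i : ℕ, n ≤ i → Subsingleton (TorMod R i M N)) ↔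
      (∀ i : ℕ, r ≤ i → Subsingleton (TorMod R i M N))
 := by
  refine ⟨fun ⟨n, hn⟩ => ?_, fun h => ⟨r, h⟩⟩
  by_contra! hex
  obtain ⟨i₀, hi₀, hi₀'⟩ := hex
  let S : Set ℕ := {i | r ≤ i ∧ Nontrivial (TorMod R i M N)}
  have hS : BddAbove S := ⟨n, fun i hi => by
    by_contra! hlt
    exact not_subsingleton_iff_nontrivial.2 hi.2 (hn i hlt.le)⟩
  obtain ⟨hp, hpt⟩ : sSup S ∈ S := Nat.sSup_mem ⟨i₀, hi₀, hi₀'⟩ hS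
  have hv (i : ℕ) (hi : sSup S < i) : Subsingleton (TorMod R i M N) := by
    by_contra h
    exact (le_csSup hS ⟨hp.trans hi.le, not_subsingleton_iff_nontrivial.1 h⟩).not_gt hi
  obtain ⟨p, hpS⟩ := Nat.exists_eq_succ_of_ne_zero (hr.trans_le hp).ne'
  rw [hpS] at hp hpt hv
  obtain ⟨D, rs, hreg, hker, hpd⟩ := exists_quasiDeformation_of_cIdim_eq M g hg
  let : Algebra R D.R' := D.φ.toAlgebra
  let : Algebra D.Q D.R' := D.ψ.toAlgebra
  have : Module.FaithfullyFlat R D.R' := D.faithfullyFlat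
  have hfull := extFull_characterModule_of_subsingleton_tor D.surj rs hker hreg M N g p hpd hv
  obtain hpg | hgp := le_or_gt (p + 1) g
  · have := finite_tor p M N
    obtain ⟨t, ht, htm⟩ := exists_smul_eq_zero_of_depth_eq_zero (TorMod R (p + 1) M N)
      ((hiv _ hp hpg).resolve_right (not_subsingleton_iff_nontrivial.2 hpt))
    obtain ⟨ys, hlen, hym, hys⟩ := exists_isWeaklyRegular_of_le_depth N (hr.trans_le hrg) hdepth
    refine not_extFull_of_smul_tor_eq_zero D.R' (Ideal.ofList ys) p M N t ht (fun a ha => htm a ?_)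
      (hfull ys hys (by omega))
    exact Ideal.span_le.2 hym ha
  · obtain ⟨t, ht⟩ := exists_ne (0 : TorMod R (p + 1) M N)
    refine not_extFull_of_smul_tor_eq_zero D.R' (Ideal.ofList []) p M N t ht (fun a ha => ?_)
      (hfull [] (RingTheory.Sequence.IsWeaklyRegular.nil R N) (by simpa using hgp))
    rw [Ideal.ofList_nil, Ideal.mem_bot] at ha
    rw [ha, zero_smul]

end
end

section
/- Let R = Q/(x) with Q local and x regular on Q, and let M, N be finitely generated R-modules. If Tor_i^Q(M,N) = 0 for all i ≥ 2, then Tor_i^R(M,N) ≅ Tor_{i+2}^R(M,N) for all i ≥ 1. -/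
open CategoryTheory

noncomputable section

universe u

variable (R : Type u) [CommRing R]

open Limits MonoidalCategory TensorProduct

namespace CategoryTheory.ProjectiveResolution

universe v₁ v₂ u₁ u₂

variable {C : Type u₁} [Category.{v₁} C] [Abelian C]

/-- The augmentation map of a projective resolution. -/
def augmentation {Z : C} (P : ProjectiveResolution Z) : P.complex.X 0 ⟶ Z := P.π.f 0

instance {Z : C} (P : ProjectiveResolution Z) : Epi P.augmentation :=
  inferInstanceAs (Epi (P.π.f 0))

@[simp]
lemma d_comp_augmentation {Z : C} (P : ProjectiveResolution Z) :
    P.complex.d 1 0 ≫ P.augmentation = 0 :=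
  P.complex_d_comp_π_f_zero

@[simp]
lemma d_comp_augmentation_assoc {Z W : C} (P : ProjectiveResolution Z) (h : Z ⟶ W) :
    P.complex.d 1 0 ≫ P.augmentation ≫ h = 0 := by
  rw [← Category.assoc, P.d_comp_augmentation, zero_comp]

/-- `Z` is the cokernel of the last differential of a projective resolution of `Z`. -/
def augmentationIsCokernel {Z : C} (P : ProjectiveResolution Z) :
    IsColimit (CokernelCofork.ofπ P.augmentation P.d_comp_augmentation) :=
  P.isColimitCokernelCofork

variable {S : ShortComplex C}

/-- The complex obtained from a projective resolution of the first term of a short complex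
by inserting the middle term in degree zero. -/
def spliceComplex (P : ProjectiveResolution S.X₁) : ChainComplex C ℕ :=
  P.complex.augment (P.augmentation ≫ S.f) (by simp)

lemma augmentation_f_g (P : ProjectiveResolution S.X₁) :
    (P.augmentation ≫ S.f) ≫ S.g = 0 := by simp

lemma splice_exact_zero (P : ProjectiveResolution S.X₁) (hS : S.Exact) :
    (ShortComplex.mk _ _ P.augmentation_f_g).Exact := by
  let α : ShortComplex.mk _ _ P.augmentation_f_g ⟶ S :=
    { τ₁ := P.augmentation
      τ₂ := 𝟙 _
      τ₃ := 𝟙 _ }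
  have : Epi α.τ₁ := inferInstanceAs (Epi P.augmentation)
  have : IsIso α.τ₂ := inferInstanceAs (IsIso (𝟙 _))
  have : Mono α.τ₃ := inferInstanceAs (Mono (𝟙 _))
  exact (ShortComplex.exact_iff_of_epi_of_isIso_of_mono α).2 hS

lemma splice_exact_one (P : ProjectiveResolution S.X₁) [Mono S.f] :
    (ShortComplex.mk (P.complex.d 1 0) (P.augmentation ≫ S.f) (by simp)).Exact := by
  let α : ShortComplex.mk _ _ P.d_comp_augmentation ⟶
      ShortComplex.mk (P.complex.d 1 0) (P.augmentation ≫ S.f) (by simp) :=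
    { τ₁ := 𝟙 _
      τ₂ := 𝟙 _
      τ₃ := S.f }
  have : Epi α.τ₁ := inferInstanceAs (Epi (𝟙 _))
  have : IsIso α.τ₂ := inferInstanceAs (IsIso (𝟙 _))
  have : Mono α.τ₃ := inferInstanceAs (Mono S.f)
  exact (ShortComplex.exact_iff_of_epi_of_isIso_of_mono α).1
    (ShortComplex.exact_of_g_is_cokernel _ P.augmentationIsCokernel)

/-- The augmentation of the spliced complex. -/
def spliceπ (P : ProjectiveResolution S.X₁) :
    P.spliceComplex ⟶ (ChainComplex.single₀ C).obj S.X₃ :=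
  (ChainComplex.toSingle₀Equiv _ _).symm ⟨S.g, P.augmentation_f_g⟩

lemma spliceπ_f_zero (P : ProjectiveResolution S.X₁) : P.spliceπ.f 0 = S.g :=
  ChainComplex.toSingle₀Equiv_symm_apply_f_zero _ _

/-- A short exact sequence with projective middle term turns a projective resolution of the
first term into a projective resolution of the third one. -/
def splice (P : ProjectiveResolution S.X₁) (hS : S.ShortExact) [Projective S.X₂] :
    ProjectiveResolution S.X₃ where
  complex := P.spliceComplex
  projective
    | 0 => inferInstanceAs (Projective S.X₂)
    | n + 1 => P.projective n
  π := P.spliceπ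
  quasiIso := ⟨fun n => by
    have hm := hS.mono_f
    have he := hS.epi_g
    match n with
    | 0 =>
      rw [ChainComplex.quasiIsoAt₀_iff, ShortComplex.quasiIso_iff_of_zeros']
      · refine (ShortComplex.exact_and_epi_g_iff_of_iso ?_).2
          ⟨P.splice_exact_zero hS.exact, he⟩
        exact ShortComplex.isoMk (Iso.refl _) (Iso.refl _) (Iso.refl _)
            ((Category.id_comp _).trans (Category.comp_id _).symm)
            ((Category.id_comp _).trans (P.spliceπ_f_zero.symm.trans (Category.comp_id _).symm))
      all_goals rfl
    | 1 =>
      rw [quasiIsoAt_iff_exactAt' _ _ (ChainComplex.exactAt_succ_single_obj _ _),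
        HomologicalComplex.exactAt_iff' _ 2 1 0 (by simp) (by simp)]
      exact P.splice_exact_one
    | n + 2 =>
      rw [quasiIsoAt_iff_exactAt' _ _ (ChainComplex.exactAt_succ_single_obj _ _),
        HomologicalComplex.exactAt_iff' _ (n + 3) (n + 2) (n + 1) (by simp) (by simp)]
      exact P.exact_succ n⟩

end CategoryTheory.ProjectiveResolution

namespace CategoryTheory.ShortComplex.ShortExact

universe v₁ v₂ u₁ u₂

variable {C : Type u₁} [Category.{v₁} C] [Abelian C] {S : ShortComplex C}
  {D : Type u₂} [Category.{v₂} D] [Abelian D] [HasProjectiveResolutions C]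

/-- Dimension shifting for left derived functors, in degrees at least two. -/
def leftDerivedSuccIso (hS : S.ShortExact) [Projective S.X₂] (F : C ⥤ D) [F.Additive] (n : ℕ) :
    (F.leftDerived (n + 2)).obj S.X₃ ≅ (F.leftDerived (n + 1)).obj S.X₁ :=
  ((projectiveResolution S.X₁).splice hS).isoLeftDerivedObj F (n + 2) ≪≫
    HomologicalComplex.homologyIsoSc' _ (n + 3) (n + 2) (n + 1)
      (ChainComplex.prev ℕ (n + 2)) (ChainComplex.next_nat_succ (n + 1)) ≪≫
    (HomologicalComplex.homologyIsoSc'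
      ((F.mapHomologicalComplex _).obj (projectiveResolution S.X₁).complex) (n + 2) (n + 1) n
      (ChainComplex.prev ℕ (n + 1)) (ChainComplex.next_nat_succ n)).symm ≪≫
    ((projectiveResolution S.X₁).isoLeftDerivedObj F (n + 1)).symm

/-- Dimension shifting for left derived functors, in degree one. -/
def leftDerivedOneIso (hS : S.ShortExact) [Projective S.X₂]
    (F : C ⥤ D) [F.Additive] [PreservesFiniteColimits F] :
    (F.leftDerived 1).obj S.X₃ ≅ kernel (F.map S.f) :=
  let P := projectiveResolution S.X₁
  have hp : IsColimit (CokernelCofork.ofπ (f := F.map (P.complex.d 1 0)) (F.map P.augmentation)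
      (by rw [← F.map_comp, P.d_comp_augmentation, F.map_zero])) :=
    CokernelCofork.mapIsColimit _ P.augmentationIsCokernel F
  have hd : hp.desc (CokernelCofork.ofπ (F.map (P.augmentation ≫ S.f))
      (by rw [← F.map_comp, P.d_comp_augmentation_assoc, F.map_zero])) = F.map S.f :=
    Cofork.IsColimit.hom_ext hp (by
      rw [Cofork.IsColimit.π_desc]
      exact F.map_comp _ _)
  (P.splice hS).isoLeftDerivedObj F 1 ≪≫
    HomologicalComplex.homologyIsoSc' _ 2 1 0 (by simp) (by simp) ≪≫
    ShortComplex.RightHomologyData.homologyIso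
     { Q := F.obj S.X₁
       H := kernel (F.map S.f)
       p := F.map P.augmentation
       ι := kernel.ι _
       wp := by exact (by rw [← F.map_comp, P.d_comp_augmentation, F.map_zero] :
          F.map (P.complex.d 1 0) ≫ F.map P.augmentation = 0)
       hp := hp
       wι := (congrArg (kernel.ι (F.map S.f) ≫ ·) hd).trans (kernel.condition _)
       hι := KernelFork.IsLimit.ofι _ _ (fun k hk => kernel.lift _ k (hd ▸ hk))
         (fun k hk => kernel.lift_ι _ _ _) (fun k hk m hm => by
            rw [← cancel_mono (kernel.ι (F.map S.f)), kernel.lift_ι]; exact hm) }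

end CategoryTheory.ShortComplex.ShortExact

section TorShift

variable {R}
variable {K P A : Type u} [AddCommGroup K] [AddCommGroup P] [AddCommGroup A]
  [Module R K] [Module R P] [Module R A] (N : ModuleCat.{u} R)

lemma shortExact_ofHom {f : K →ₗ[R] P} {g : P →ₗ[R] A} (hf : Function.Injective f)
    (hfg : Function.Exact f g) (hg : Function.Surjective g) :
    (ShortComplex.mk (ModuleCat.ofHom f) (ModuleCat.ofHom g)
      (by ext x; exact hfg.apply_apply_eq_zero x)).ShortExact :=
  ModuleCat.shortComplex_shortExact _ hfg hf hg

/-- Dimension shifting for `Tor`, in degrees at least two. -/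
theorem nonempty_torMod_succ_equiv [Module.Projective R P] {f : K →ₗ[R] P} {g : P →ₗ[R] A}
    (hf : Function.Injective f) (hfg : Function.Exact f g) (hg : Function.Surjective g) (n : ℕ) :
    Nonempty (TorMod R (n + 2) (ModuleCat.of R A) N ≃ₗ[R]
      TorMod R (n + 1) (ModuleCat.of R K) N) := by
  have hP : Projective (ModuleCat.of R P) := inferInstance
  exact ⟨((shortExact_ofHom hf hfg hg).leftDerivedSuccIso
    ((tensoringRight (ModuleCat.{u} R)).obj N) n).toLinearEquiv⟩

/-- Dimension shifting for `Tor`, in degree one. -/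
theorem nonempty_torMod_one_equiv [Module.Projective R P] {f : K →ₗ[R] P} {g : P →ₗ[R] A}
    (hf : Function.Injective f) (hfg : Function.Exact f g) (hg : Function.Surjective g) :
    Nonempty (TorMod R 1 (ModuleCat.of R A) N ≃ₗ[R] LinearMap.ker (f.rTensor N)) := by
  have hP : Projective (ModuleCat.of R P) := inferInstance
  have : PreservesFiniteColimits ((tensoringRight (ModuleCat.{u} R)).obj N) :=
    inferInstanceAs (PreservesFiniteColimits (tensorRight N))
  exact ⟨((shortExact_ofHom hf hfg hg).leftDerivedOneIso
    ((tensoringRight (ModuleCat.{u} R)).obj N)).toLinearEquiv.trans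
    (ModuleCat.kernelIsoKer _).toLinearEquiv⟩

variable (A) in
/-- Every module is a quotient of a projective module. -/
lemma exists_projective_cover : ∃ (P : Type u) (_ : AddCommGroup P) (_ : Module R P)
    (_ : Module.Projective R P) (p : P →ₗ[R] A), Function.Surjective p :=
  ⟨A →₀ R, _, _, inferInstance, _, Finsupp.linearCombination_id_surjective R A⟩

theorem rTensor_subtype_injective [Module.Projective R P] {g : P →ₗ[R] A}
    (hg : Function.Surjective g) (hA : Subsingleton (TorMod R 1 (ModuleCat.of R A) N)) :
    Function.Injective ((LinearMap.ker g).subtype.rTensor N) := by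
  obtain ⟨e⟩ := nonempty_torMod_one_equiv N (LinearMap.ker g).injective_subtype
    g.exact_subtype_ker_map hg
  have := e.symm.toEquiv.subsingleton
  rw [← LinearMap.ker_eq_bot]
  exact Submodule.subsingleton_iff_eq_bot.1 this

variable {B C : Type u} [AddCommGroup B] [AddCommGroup C] [Module R B] [Module R C]

/-- If `Tor₁(B, N) = 0`, then a short exact sequence `0 → A → B → C → 0` identifies `Tor₁(C, N)`
with the kernel of `A ⊗ N → B ⊗ N`. -/
theorem nonempty_torMod_one_equiv_of_subsingleton {f : A →ₗ[R] B} {g : B →ₗ[R] C}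
    (hf : Function.Injective f) (hfg : Function.Exact f g) (hg : Function.Surjective g)
    (hB : Subsingleton (TorMod R 1 (ModuleCat.of R B) N)) :
    Nonempty (TorMod R 1 (ModuleCat.of R C) N ≃ₗ[R] LinearMap.ker (f.rTensor N)) := by
  obtain ⟨P, _, _, _, σ, hσ⟩ := exists_projective_cover (R := R) B
  let iB := (LinearMap.ker σ).subtype
  let iC := (LinearMap.ker (g ∘ₗ σ)).subtype
  let j : LinearMap.ker σ →ₗ[R] LinearMap.ker (g ∘ₗ σ) :=
    Submodule.inclusion (LinearMap.ker_le_ker_comp σ g)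
  let h : LinearMap.ker (g ∘ₗ σ) →ₗ[R] A := (LinearEquiv.ofInjective f hf).symm.toLinearMap ∘ₗ
    (σ ∘ₗ iC).codRestrict (LinearMap.range f) fun z => (hfg (σ z)).1 z.2
  have hh (z) : f (h z) = σ z :=
    congrArg Subtype.val ((LinearEquiv.ofInjective f hf).apply_symm_apply _)
  have hfh : f ∘ₗ h = σ ∘ₗ iC := LinearMap.ext hh
  have hij : iC ∘ₗ j = iB := rfl
  have hh_surj : Function.Surjective h := fun a => by
    obtain ⟨y, hy⟩ := hσ (f a)
    exact ⟨⟨y, by simp [hy, hfg.apply_apply_eq_zero]⟩, hf ((hh _).trans hy)⟩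
  have hjh : Function.Exact j h := fun z => by
    rw [← map_eq_zero_iff f hf, hh]
    exact ⟨fun hz => ⟨⟨z, hz⟩, rfl⟩, by rintro ⟨y, rfl⟩; exact y.2⟩
  have hjhN : Function.Exact (j.rTensor N) (h.rTensor N) :=
    rTensor_exact N hjh hh_surj
  have hσN := rTensor_exact N σ.exact_subtype_ker_map hσ
  have hiB : Function.Injective (iB.rTensor N) := rTensor_subtype_injective N hσ hB
  have hfhN (z) : f.rTensor N (h.rTensor N z) = σ.rTensor N (iC.rTensor N z) := by
    rw [← LinearMap.rTensor_comp_apply, hfh, LinearMap.rTensor_comp_apply]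
  have hijN (z) : iC.rTensor N (j.rTensor N z) = iB.rTensor N z := by
    rw [← LinearMap.rTensor_comp_apply, hij]
  obtain ⟨e⟩ := nonempty_torMod_one_equiv N (LinearMap.ker (g ∘ₗ σ)).injective_subtype
    (g ∘ₗ σ).exact_subtype_ker_map (hg.comp hσ)
  refine ⟨e.trans (LinearEquiv.ofBijective ((h.rTensor N).restrict
    (p := LinearMap.ker (iC.rTensor N)) (q := LinearMap.ker (f.rTensor N)) fun z hz => ?_) ⟨?_, ?_⟩)⟩
  · rw [LinearMap.mem_ker, hfhN, LinearMap.mem_ker.1 hz, map_zero]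
  · refine (injective_iff_map_eq_zero _).2 ?_
    rintro ⟨z, hz⟩ hz'
    obtain ⟨w, rfl⟩ := (hjhN z).1 (congrArg Subtype.val hz')
    rw [LinearMap.mem_ker, hijN, map_eq_zero_iff _ hiB] at hz
    simp [hz]
  · rintro ⟨a, ha⟩
    obtain ⟨z, rfl⟩ := LinearMap.rTensor_surjective N hh_surj a
    rw [LinearMap.mem_ker, hfhN] at ha
    obtain ⟨w, hw⟩ := (hσN _).1 ha
    have hz : iC.rTensor N (z - j.rTensor N w) = 0 := by
      rw [map_sub, hijN, sub_eq_zero]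
      exact hw.symm
    refine ⟨⟨z - j.rTensor N w, hz⟩, Subtype.ext ?_⟩
    exact (map_sub (h.rTensor N) z (j.rTensor N w)).trans
      (by rw [hjhN.apply_apply_eq_zero w, sub_zero])

/-- The kernels of compatible projective covers of a short exact sequence form a short exact
sequence. -/
lemma exists_exact_ker {P₁ P₃ : Type u} [AddCommGroup P₁] [AddCommGroup P₃] [Module R P₁]
    [Module R P₃] {f : A →ₗ[R] B} {g : B →ₗ[R] C}
    (hf : Function.Injective f) (hfg : Function.Exact f g)
    {p : P₁ →ₗ[R] A} (hp : Function.Surjective p) (σ : P₃ →ₗ[R] B) :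
    ∃ (i : LinearMap.ker p →ₗ[R] LinearMap.ker ((f ∘ₗ p).coprod σ))
      (s : LinearMap.ker ((f ∘ₗ p).coprod σ) →ₗ[R] LinearMap.ker (g ∘ₗ σ)),
      Function.Injective i ∧ Function.Exact i s ∧ Function.Surjective s ∧
      (LinearMap.ker ((f ∘ₗ p).coprod σ)).subtype ∘ₗ i =
        LinearMap.inl R P₁ P₃ ∘ₗ (LinearMap.ker p).subtype := by
  refine ⟨(LinearMap.inl R _ _).restrict fun y hy => by simp_all,
    (LinearMap.snd R _ _).restrict fun y hy => ?_, fun y z hyz =>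
      Subtype.ext (congrArg Prod.fst (congrArg Subtype.val hyz)), ?_, ?_, rfl⟩
  · have := congrArg g (LinearMap.mem_ker.1 hy)
    simpa [hfg.apply_apply_eq_zero] using this
  · rintro ⟨⟨y, z⟩, hyz⟩
    refine ⟨fun h => ?_, ?_⟩
    · obtain rfl : z = 0 := congrArg Subtype.val h
      refine ⟨⟨y, ?_⟩, rfl⟩
      simpa [map_eq_zero_iff f hf] using hyz
    · rintro ⟨w, hw⟩
      rw [← hw]
      rfl
  · rintro ⟨z, hz⟩
    obtain ⟨a, ha⟩ := (hfg (σ z)).1 hz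
    obtain ⟨y, rfl⟩ := hp a
    exact ⟨⟨(-y, z), by simp [ha]⟩, rfl⟩

end TorShift

/-- Dimension shifting along a short exact sequence whose middle term is `Tor`-acyclic. -/
theorem nonempty_torMod_equiv_of_acyclic {R : Type u} [CommRing R] (N : ModuleCat.{u} R) (n : ℕ) :
    ∀ {A B C : Type u} [AddCommGroup A] [AddCommGroup B] [AddCommGroup C]
      [Module R A] [Module R B] [Module R C] {f : A →ₗ[R] B} {g : B →ₗ[R] C},
      Function.Injective f → Function.Exact f g → Function.Surjective g →
      (∀ i, Subsingleton (TorMod R (i + 1) (ModuleCat.of R B) N)) →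
      Nonempty (TorMod R (n + 2) (ModuleCat.of R C) N ≃ₗ[R]
        TorMod R (n + 1) (ModuleCat.of R A) N) := by
  induction n with
  | zero => ?_
  | succ n ih => ?_
  all_goals
    intro A B C _ _ _ _ _ _ f g hf hfg hg hB
    obtain ⟨P₁, _, _, _, p, hp⟩ := exists_projective_cover (R := R) A
    obtain ⟨P₃, _, _, _, σ, hσ⟩ := exists_projective_cover (R := R) B
    obtain ⟨i, s, hi, his, hs, hcomm⟩ := exists_exact_ker hf hfg hp σ
    have hq : Function.Surjective (g ∘ₗ σ) := hg.comp hσ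
    have hr : Function.Surjective ((f ∘ₗ p).coprod σ) := fun b => by
      obtain ⟨y, rfl⟩ := hσ b
      exact ⟨(0, y), by simp⟩
    generalize (f ∘ₗ p).coprod σ = r at *
    generalize g ∘ₗ σ = q at *
    have hker (n : ℕ) : Subsingleton (TorMod R (n + 1) (ModuleCat.of R (LinearMap.ker r)) N) := by
      obtain ⟨e⟩ := nonempty_torMod_succ_equiv N (LinearMap.ker r).injective_subtype
        (LinearMap.exact_subtype_ker_map r) hr n
      have := hB (n + 1)
      exact e.symm.toEquiv.subsingleton
  · obtain ⟨e₁⟩ := nonempty_torMod_succ_equiv N (LinearMap.ker q).injective_subtype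
      q.exact_subtype_ker_map hq 0
    obtain ⟨e₂⟩ := nonempty_torMod_one_equiv_of_subsingleton N hi his hs (hker 0)
    obtain ⟨e₃⟩ := nonempty_torMod_one_equiv N (LinearMap.ker p).injective_subtype
      p.exact_subtype_ker_map hp
    have hinl : Function.Injective ((LinearMap.inl R P₁ P₃).rTensor N) :=
      Function.LeftInverse.injective (g := (LinearMap.fst R _ _).rTensor N) fun z => by
        rw [← LinearMap.rTensor_comp_apply, LinearMap.fst_comp_inl, LinearMap.rTensor_id_apply]
    have hk : LinearMap.ker (i.rTensor N) = LinearMap.ker ((LinearMap.ker p).subtype.rTensor N) := by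
      rw [← LinearMap.ker_comp_of_ker_eq_bot (i.rTensor N)
          (LinearMap.ker_eq_bot.2 (rTensor_subtype_injective N hr (hB 0))),
        ← LinearMap.rTensor_comp, hcomm, LinearMap.rTensor_comp,
        LinearMap.ker_comp_of_ker_eq_bot _ (LinearMap.ker_eq_bot.2 hinl)]
    exact ⟨e₁.trans (e₂.trans ((LinearEquiv.ofEq _ _ hk).trans e₃.symm))⟩
  · obtain ⟨e₁⟩ := nonempty_torMod_succ_equiv N (LinearMap.ker q).injective_subtype
      q.exact_subtype_ker_map hq (n + 1)
    obtain ⟨e₂⟩ := ih hi his hs hker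
    obtain ⟨e₃⟩ := nonempty_torMod_succ_equiv N (LinearMap.ker p).injective_subtype
      p.exact_subtype_ker_map hp n
    exact ⟨e₁.trans (e₂.trans e₃.symm)⟩

section ChangeOfRings

variable {Q : Type u} [CommRing Q] {x : Q}

lemma quotient_mk_tmul_eq_zero_iff {K : Type u} [AddCommGroup K] [Module Q K] (k : K) :
    (1 : Q ⧸ Ideal.span {x}) ⊗ₜ[Q] k = 0 ↔ ∃ k', x • k' = k := by
  have := LinearMap.ker_tensorProductMk (Q := K) (I := Ideal.span {x})
  rw [← TensorProduct.mk_apply, ← LinearMap.mem_ker, this, Submodule.ideal_span_singleton_smul,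
    Submodule.mem_smul_pointwise_iff_exists]
  simp

lemma exists_one_tmul_eq {K : Type u} [AddCommGroup K] [Module Q K]
    (z : (Q ⧸ Ideal.span {x}) ⊗[Q] K) : ∃ k : K, 1 ⊗ₜ[Q] k = z :=
  TensorProduct.mk_surjective Q K (Q ⧸ Ideal.span {x}) Ideal.Quotient.mk_surjective z

/-- Every module is a quotient of a projective module on which a given non-zero-divisor acts
injectively. -/
lemma exists_regular_projective_cover (hx : x ∈ nonZeroDivisors Q) (A : Type u) [AddCommGroup A]
    [Module Q A] : ∃ (P : Type u) (_ : AddCommGroup P) (_ : Module Q P)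
    (_ : Module.Projective Q P) (p : P →ₗ[Q] A), Function.Surjective p ∧ IsSMulRegular P x := by
  refine ⟨A →₀ Q, _, _, inferInstance, _, Finsupp.linearCombination_id_surjective Q A,
    fun y z h => Finsupp.ext fun a => ?_⟩
  have := DFunLike.congr_fun h a
  exact (mul_cancel_left_mem_nonZeroDivisors hx).1 (by simpa using this)

/-- Reduction modulo `x` preserves the exactness of `0 → K → P → A → 0` if `x` is `A`-regular. -/
lemma baseChange_injective {K P A : Type u} [AddCommGroup K] [AddCommGroup P] [AddCommGroup A]
    [Module Q K] [Module Q P] [Module Q A] {f : K →ₗ[Q] P} {g : P →ₗ[Q] A}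
    (hf : Function.Injective f) (hfg : Function.Exact f g) (hA : IsSMulRegular A x) :
    Function.Injective (f.baseChange (Q ⧸ Ideal.span {x})) := by
  refine (injective_iff_map_eq_zero _).2 fun z hz => ?_
  obtain ⟨k, rfl⟩ := exists_one_tmul_eq z
  rw [LinearMap.baseChange_tmul, quotient_mk_tmul_eq_zero_iff] at hz
  obtain ⟨p, hp⟩ := hz
  have hgp : g p = 0 := hA.right_eq_zero_of_smul (by
    rw [← map_smul, hp, hfg.apply_apply_eq_zero])
  obtain ⟨k', rfl⟩ := (hfg p).1 hgp
  exact (quotient_mk_tmul_eq_zero_iff k).2 ⟨k', hf (by rw [map_smul, hp])⟩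

/-- If `f` stays injective after tensoring over `Q` with an `R`-module `N`, then its base change to
`R` stays injective after tensoring over `R` with `N`. -/
lemma rTensor_baseChange_injective {R K P : Type u} [CommRing R] [Algebra Q R] [AddCommGroup K]
    [AddCommGroup P] [Module Q K] [Module Q P] {f : K →ₗ[Q] P} {N : Type u} [AddCommGroup N]
    [Module Q N] [Module R N] [IsScalarTower Q R N]
    (h : Function.Injective (f.rTensor N)) :
    Function.Injective ((f.baseChange R).rTensor N) := by
  rw [← LinearMap.lTensor_inj_iff_rTensor_inj] at h ⊢
  intro y z hyz
  let e₁ := TensorProduct.AlgebraTensorModule.cancelBaseChange Q R R N K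
  let e₂ := TensorProduct.AlgebraTensorModule.cancelBaseChange Q R R N P
  have he (w) : f.lTensor N (e₁ w) = e₂ ((f.baseChange R).lTensor N w) :=
    LinearMap.congr_fun (TensorProduct.AlgebraTensorModule.lTensor_comp_cancelBaseChange Q R R f) w
  exact e₁.injective (h (by rw [he, he, hyz]))

/-- If `x` is regular on `Q` and on `K`, then `Tor`-vanishing of `K` over `Q` passes to `K / xK`
over `Q / xQ`. -/
theorem subsingleton_torMod_baseChange (hx : x ∈ nonZeroDivisors Q) (N : Type u) [AddCommGroup N]
    [Module Q N] [Module (Q ⧸ Ideal.span {x}) N] [IsScalarTower Q (Q ⧸ Ideal.span {x}) N]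
    (n : ℕ) : ∀ {K : Type u} [AddCommGroup K] [Module Q K], IsSMulRegular K x →
      (∀ i, Subsingleton (TorMod Q (i + 1) (ModuleCat.of Q K) (ModuleCat.of Q N))) →
      Subsingleton (TorMod (Q ⧸ Ideal.span {x}) (n + 1)
        (ModuleCat.of _ ((Q ⧸ Ideal.span {x}) ⊗[Q] K)) (ModuleCat.of _ N)) := by
  induction n with
  | zero => ?_
  | succ n ih => ?_
  all_goals
    intro K _ _ hK h
    obtain ⟨P, _, _, _, p, hp, hP⟩ := exists_regular_projective_cover hx K
    have hinj := baseChange_injective (LinearMap.ker p).injective_subtype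
      p.exact_subtype_ker_map hK
    have hexact : Function.Exact ((LinearMap.ker p).subtype.baseChange (Q ⧸ Ideal.span {x}))
        (p.baseChange (Q ⧸ Ideal.span {x})) :=
      lTensor_exact (Q ⧸ Ideal.span {x}) p.exact_subtype_ker_map hp
    have hsurj : Function.Surjective (p.baseChange (Q ⧸ Ideal.span {x})) :=
      LinearMap.lTensor_surjective (Q ⧸ Ideal.span {x}) hp
  · obtain ⟨e⟩ := nonempty_torMod_one_equiv (ModuleCat.of _ N) hinj hexact hsurj
    have : Subsingleton (LinearMap.ker (((LinearMap.ker p).subtype.baseChange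
        (Q ⧸ Ideal.span {x})).rTensor N)) := by
      rw [Submodule.subsingleton_iff_eq_bot]
      exact LinearMap.ker_eq_bot_of_injective (rTensor_baseChange_injective
        (rTensor_subtype_injective (ModuleCat.of Q N) hp (h 0)))
    exact e.toEquiv.subsingleton
  · obtain ⟨e⟩ := nonempty_torMod_succ_equiv (ModuleCat.of _ N) hinj hexact hsurj n
    have := ih (K := LinearMap.ker p)
      (hP.of_injective (LinearMap.ker p).subtype (LinearMap.ker p).injective_subtype) fun i => by
        obtain ⟨e'⟩ := nonempty_torMod_succ_equiv (ModuleCat.of Q N)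
          (LinearMap.ker p).injective_subtype p.exact_subtype_ker_map hp i
        have := h (i + 1)
        exact e'.symm.toEquiv.subsingleton
    exact e.toEquiv.subsingleton

/-- For a `Q / xQ`-module `M` with cover `π : F → M` and kernel `K`, where `x` is `F`-regular,
multiplication by `x` makes `0 → M → K / xK → F / xF → M → 0` exact. -/
lemma exists_exact_baseChange_ker {F M : Type u} [AddCommGroup F] [AddCommGroup M] [Module Q F]
    [Module Q M] [Module (Q ⧸ Ideal.span {x}) M] [IsScalarTower Q (Q ⧸ Ideal.span {x}) M]
    (hF : IsSMulRegular F x) {π : F →ₗ[Q] M} (hπ : Function.Surjective π) :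
    ∃ (s : M →ₗ[Q ⧸ Ideal.span {x}] (Q ⧸ Ideal.span {x}) ⊗[Q] LinearMap.ker π)
      (t : (Q ⧸ Ideal.span {x}) ⊗[Q] LinearMap.ker π →ₗ[Q ⧸ Ideal.span {x}]
        LinearMap.ker (π.liftBaseChange (Q ⧸ Ideal.span {x}))),
      Function.Injective s ∧ Function.Exact s t ∧ Function.Surjective t := by
  have hxM (m : M) : x • m = 0 := by
    rw [← algebraMap_smul (Q ⧸ Ideal.span {x}) x m, Ideal.Quotient.algebraMap_eq,
      Ideal.Quotient.eq_zero_iff_mem.2 (Ideal.mem_span_singleton_self x), zero_smul]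
  let T₀ : F →ₗ[Q] LinearMap.ker π :=
    (LinearMap.lsmul Q F x).codRestrict (LinearMap.ker π) fun v => by simp [hxM]
  let T : F →ₗ[Q] (Q ⧸ Ideal.span {x}) ⊗[Q] LinearMap.ker π :=
    TensorProduct.mk Q (Q ⧸ Ideal.span {x}) (LinearMap.ker π) 1 ∘ₗ T₀
  have hT (v) : T v = 0 ↔ π v = 0 := by
    refine (quotient_mk_tmul_eq_zero_iff (T₀ v)).trans ⟨?_, fun hv => ⟨⟨v, hv⟩, rfl⟩⟩
    rintro ⟨k, hk⟩
    obtain rfl : (k : F) = v := hF (congrArg Subtype.val hk)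
    exact k.2
  let s : M →ₗ[Q] (Q ⧸ Ideal.span {x}) ⊗[Q] LinearMap.ker π :=
    (LinearMap.ker π).liftQ T (fun v hv => (hT v).2 hv) ∘ₗ
      (π.quotKerEquivOfSurjective hπ).symm.toLinearMap
  have hs (v) : s (π v) = T v := by
    have : (π.quotKerEquivOfSurjective hπ).symm (π v) = Submodule.Quotient.mk v := by
      rw [LinearEquiv.symm_apply_eq]
      rfl
    exact congrArg ((LinearMap.ker π).liftQ T fun v hv => (hT v).2 hv) this
  let t := ((LinearMap.ker π).subtype.baseChange (Q ⧸ Ideal.span {x})).codRestrict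
    (LinearMap.ker (π.liftBaseChange (Q ⧸ Ideal.span {x}))) fun z => by
      obtain ⟨k, rfl⟩ := exists_one_tmul_eq z
      simp
  refine ⟨s.extendScalarsOfSurjective Ideal.Quotient.mk_surjective, t, ?_, ?_, ?_⟩
  · refine (injective_iff_map_eq_zero _).2 fun m hm => ?_
    obtain ⟨v, rfl⟩ := hπ m
    exact (hT v).1 ((hs v).symm.trans hm)
  · intro z
    obtain ⟨k, rfl⟩ := exists_one_tmul_eq z
    have ht : t (1 ⊗ₜ[Q] k) = 0 ↔ (1 : Q ⧸ Ideal.span {x}) ⊗ₜ[Q] (k : F) = 0 :=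
      Subtype.ext_iff
    rw [ht, quotient_mk_tmul_eq_zero_iff]
    constructor
    · rintro ⟨v, hv⟩
      refine ⟨π v, (hs v).trans ?_⟩
      exact congrArg (1 ⊗ₜ[Q] ·) (Subtype.ext hv)
    · rintro ⟨m, hm⟩
      obtain ⟨v, rfl⟩ := hπ m
      rw [← quotient_mk_tmul_eq_zero_iff]
      have h : T v = 1 ⊗ₜ[Q] k := (hs v).symm.trans hm
      have h' : t (T v) = 0 := Subtype.ext ((quotient_mk_tmul_eq_zero_iff (x • v)).2 ⟨v, rfl⟩)
      exact ht.1 (h ▸ h')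
  · rintro ⟨z, hz⟩
    obtain ⟨v, rfl⟩ := exists_one_tmul_eq z
    have hv : π v = 0 := by simpa using hz
    exact ⟨1 ⊗ₜ ⟨v, hv⟩, rfl⟩

/-- If `Tor^Q_i(M, N) = 0` for `i ≥ 2`, then `Tor(M, N)` over `Q / xQ` is two-periodic in positive
degrees. -/
theorem nonempty_torMod_equiv_add_two (hx : x ∈ nonZeroDivisors Q) (M N : Type u) [AddCommGroup M]
    [AddCommGroup N] [Module Q M] [Module Q N] [Module (Q ⧸ Ideal.span {x}) M]
    [Module (Q ⧸ Ideal.span {x}) N] [IsScalarTower Q (Q ⧸ Ideal.span {x}) M]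
    [IsScalarTower Q (Q ⧸ Ideal.span {x}) N]
    (h : ∀ i, Subsingleton (TorMod Q (i + 2) (ModuleCat.of Q M) (ModuleCat.of Q N))) (n : ℕ) :
    Nonempty (TorMod (Q ⧸ Ideal.span {x}) (n + 1) (ModuleCat.of _ M) (ModuleCat.of _ N)
      ≃ₗ[Q ⧸ Ideal.span {x}]
        TorMod (Q ⧸ Ideal.span {x}) (n + 3) (ModuleCat.of _ M) (ModuleCat.of _ N)) := by
  obtain ⟨F, _, _, _, π, hπ, hF⟩ := exists_regular_projective_cover hx M
  obtain ⟨s, t, hs, hst, ht⟩ := exists_exact_baseChange_ker hF hπ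
  have hπ' : Function.Surjective (π.liftBaseChange (Q ⧸ Ideal.span {x})) := fun m => by
    obtain ⟨v, rfl⟩ := hπ m
    exact ⟨1 ⊗ₜ v, by simp⟩
  obtain ⟨e₁⟩ := nonempty_torMod_succ_equiv (ModuleCat.of (Q ⧸ Ideal.span {x}) N)
    (LinearMap.ker (π.liftBaseChange (Q ⧸ Ideal.span {x}))).injective_subtype
    (LinearMap.exact_subtype_ker_map _) hπ' (n + 1)
  obtain ⟨e₂⟩ := nonempty_torMod_equiv_of_acyclic (ModuleCat.of (Q ⧸ Ideal.span {x}) N) n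
    (C := LinearMap.ker (π.liftBaseChange (Q ⧸ Ideal.span {x}))) hs hst ht
    fun j => subsingleton_torMod_baseChange hx N j
      (hF.of_injective (LinearMap.ker π).subtype (LinearMap.ker π).injective_subtype) fun i => by
        obtain ⟨e⟩ := nonempty_torMod_succ_equiv (ModuleCat.of Q N)
          (LinearMap.ker π).injective_subtype π.exact_subtype_ker_map hπ i
        have := h i
        exact e.symm.toEquiv.subsingleton
  exact ⟨(e₁.trans e₂).symm⟩

end ChangeOfRings

theorem stmt13 (Q : Type u) [CommRing Q] [IsLocalRing Q]
    (x : Q) (hreg : x ∈ nonZeroDivisors Q)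
    (M N : ModuleCat.{u} (Q ⧸ Ideal.span {x}))
    (hM : Module.Finite (Q ⧸ Ideal.span {x}) M)
    (hN : Module.Finite (Q ⧸ Ideal.span {x}) N)
    (hvan : ∀ i : ℕ, 2 ≤ i →
      Subsingleton (TorMod Q i
        ((ModuleCat.restrictScalars (Ideal.Quotient.mk (Ideal.span {x}))).obj M)
        ((ModuleCat.restrictScalars (Ideal.Quotient.mk (Ideal.span {x}))).obj N))) :
    ∀ i : ℕ, 1 ≤ i →
      Nonempty ((TorMod (Q ⧸ Ideal.span {x}) i M N) ≃ₗ[Q ⧸ Ideal.span {x}]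
        (TorMod (Q ⧸ Ideal.span {x}) (i + 2) M N)) := by
  intro i hi
  obtain ⟨n, rfl⟩ := Nat.exists_eq_add_of_le' hi
  let _ := Module.compHom M (Ideal.Quotient.mk (Ideal.span {x}))
  let _ := Module.compHom N (Ideal.Quotient.mk (Ideal.span {x}))
  have : IsScalarTower Q (Q ⧸ Ideal.span {x}) M := .of_algebraMap_smul fun _ _ => rfl
  have : IsScalarTower Q (Q ⧸ Ideal.span {x}) N := .of_algebraMap_smul fun _ _ => rfl
  exact nonempty_torMod_equiv_add_two hreg M N (fun i => hvan (i + 2) (by omega)) n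

end
end

section
/- Let R be a Gorenstein local ring and M a finitely generated R-module of finite Gorenstein dimension. Then syz_R(M) = depth_R(R) if and only if M is totally reflexive. -/
open CategoryTheory

noncomputable section

universe u

variable (R : Type u) [CommRing R]

section ExtVanishing

variable {R}

/-- The derived-functor `Ext` vanishes iff the derived-category `Ext` does. -/
lemma subsingleton_extMod_succ_iff (n : ℕ) (X Y : ModuleCat.{u} R) :
    Subsingleton (ExtMod R (n + 1) X Y) ↔ Subsingleton (Abelian.Ext X Y (n + 1)) := by
  let P := projectiveResolution X
  have h₁ : Subsingleton (ExtMod R (n + 1) X Y) ↔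
      ∀ f : P.complex.X (n + 1) ⟶ Y, P.complex.d (n + 2) (n + 1) ≫ f = 0 →
        ∃ g : P.complex.X n ⟶ Y, P.complex.d (n + 1) n ≫ g = f := by
    rw [← ModuleCat.isZero_iff_subsingleton, (P.isoExt (n + 1) Y).isZero_iff,
      ← HomologicalComplex.exactAt_iff_isZero_homology,
      HomologicalComplex.exactAt_iff' _ n (n + 1) (n + 2) (by simp) (by simp),
      ShortComplex.moduleCat_exact_iff]
    rfl
  rw [h₁]
  constructor
  · intro h
    refine subsingleton_of_forall_eq 0 fun e => ?_
    obtain ⟨f, hf, rfl⟩ := P.extMk_surjective e (n + 2) rfl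
    exact (P.extMk_eq_zero_iff f (n + 2) rfl hf n rfl).2 (h f hf)
  · intro h f hf
    exact (P.extMk_eq_zero_iff f (n + 2) rfl hf n rfl).1 (Subsingleton.elim _ _)

lemma subsingleton_extMod_iff {i : ℕ} (hi : 0 < i) (X Y : ModuleCat.{u} R) :
    Subsingleton (ExtMod R i X Y) ↔ Subsingleton (Abelian.Ext X Y i) := by
  obtain ⟨n, rfl⟩ := Nat.exists_eq_add_of_lt hi
  rw [zero_add]
  exact subsingleton_extMod_succ_iff n X Y

lemma CategoryTheory.ShortComplex.ShortExact.subsingleton_ext_X₂ {S : ShortComplex (ModuleCat.{u} R)}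
    (hS : S.ShortExact) (Y : ModuleCat.{u} R) {i : ℕ}
    (h₁ : Subsingleton (Abelian.Ext S.X₁ Y i)) (h₃ : Subsingleton (Abelian.Ext S.X₃ Y i)) :
    Subsingleton (Abelian.Ext S.X₂ Y i) := by
  refine subsingleton_of_forall_eq 0 fun x => ?_
  obtain ⟨y, rfl⟩ := Abelian.Ext.contravariant_sequence_exact₂ hS Y x (Subsingleton.elim _ _)
  rw [Subsingleton.elim y 0, Abelian.Ext.comp_zero]

lemma CategoryTheory.ShortComplex.ShortExact.subsingleton_ext_X₁ {S : ShortComplex (ModuleCat.{u} R)}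
    (hS : S.ShortExact) (Y : ModuleCat.{u} R) {i : ℕ}
    (h₂ : Subsingleton (Abelian.Ext S.X₂ Y i)) (h₃ : Subsingleton (Abelian.Ext S.X₃ Y (i + 1))) :
    Subsingleton (Abelian.Ext S.X₁ Y i) := by
  refine subsingleton_of_forall_eq 0 fun x => ?_
  obtain ⟨y, rfl⟩ := Abelian.Ext.contravariant_sequence_exact₁ hS Y x (add_comm 1 i)
    (Subsingleton.elim _ _)
  rw [Subsingleton.elim y 0, Abelian.Ext.comp_zero]

end ExtVanishing

section Syzygy

variable {R}

lemma IsNthSyzygy.exists_subsingleton_ext {t : ℕ} {M : ModuleCat.{u} R} (h : IsNthSyzygy R t M)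
    (Y : ModuleCat.{u} R) :
    ∃ C : ModuleCat.{u} R, ∀ i : ℕ, 0 < i →
      Subsingleton (Abelian.Ext C Y (i + t)) → Subsingleton (Abelian.Ext M Y i) := by
  induction t generalizing M with
  | zero => exact ⟨M, fun i _ h => h⟩
  | succ t ih =>
    obtain ⟨F, D, f, g, w, hF, hS, hD⟩ := h
    obtain ⟨C, hC⟩ := ih hD
    refine ⟨C, fun i hi hv => hS.subsingleton_ext_X₁ Y ?_ (hC (i + 1) (by lia) ?_)⟩
    · obtain ⟨j, rfl⟩ := Nat.exists_eq_add_of_lt hi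
      have : Projective F := ModuleCat.projective_of_free (Module.Free.chooseBasis R F)
      exact subsingleton_of_forall_eq 0 fun e => e.eq_zero_of_projective
    · rwa [add_right_comm]

lemma IsNthSyzygy.of_iso {t : ℕ} {M N : ModuleCat.{u} R} (e : N ≅ M) (h : IsNthSyzygy R t M) :
    IsNthSyzygy R t N := by
  cases t with
  | zero => trivial
  | succ t =>
    obtain ⟨F, D, f, g, w, hF, hS, hD⟩ := h
    refine ⟨F, D, e.hom ≫ f, g, by simp [w], hF, ?_, hD⟩
    refine ShortComplex.shortExact_of_iso (S₁ := ShortComplex.mk f g w) ?_ hS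
    exact ShortComplex.isoMk e.symm (Iso.refl _) (Iso.refl _) (by simp) (by simp)

lemma IsNthSyzygy.of_linearEquiv {t : ℕ} {M N : ModuleCat.{u} R} (e : N ≃ₗ[R] M)
    (h : IsNthSyzygy R t M) : IsNthSyzygy R t N :=
  h.of_iso e.toModuleIso

end Syzygy

section Dual

variable {R}

/-- The `R`-dual of a short complex. -/
def dualShortComplex (S : ShortComplex (ModuleCat.{u} R)) : ShortComplex (ModuleCat.{u} R) :=
  ShortComplex.mk (X₁ := ModuleCat.of R (Module.Dual R S.X₃))
    (X₂ := ModuleCat.of R (Module.Dual R S.X₂)) (X₃ := ModuleCat.of R (Module.Dual R S.X₁))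
    (ModuleCat.ofHom S.g.hom.dualMap) (ModuleCat.ofHom S.f.hom.dualMap) (by
      ext φ x
      have : S.g.hom (S.f.hom x) = 0 :=
        ConcreteCategory.congr_hom S.zero x
      simp [this])

lemma CategoryTheory.ShortComplex.ShortExact.dual {S : ShortComplex (ModuleCat.{u} R)}
    (hS : S.ShortExact) (h : Subsingleton (Abelian.Ext S.X₃ (ModuleCat.of R R) 1)) :
    (dualShortComplex S).ShortExact := by
  have hex : Function.Exact S.f.hom S.g.hom :=
    (ShortComplex.ShortExact.moduleCat_exact_iff_function_exact _).1 hS.exact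
  have hsurj : Function.Surjective S.g.hom := hS.moduleCat_surjective_g
  apply ModuleCat.shortComplex_shortExact
  · exact LinearMap.exact_lcomp_of_exact_of_surjective R hex hsurj
  · exact LinearMap.dualMap_injective_of_surjective hsurj
  · intro φ
    obtain ⟨x, hx⟩ := Abelian.Ext.contravariant_sequence_exact₁ hS (ModuleCat.of R R)
      (Abelian.Ext.mk₀ (ModuleCat.ofHom φ : S.X₁ ⟶ ModuleCat.of R R)) (add_zero 1)
      (Subsingleton.elim _ _)
    obtain ⟨ψ, rfl⟩ := Abelian.Ext.addEquiv₀.symm.surjective x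
    refine ⟨ψ.hom, ?_⟩
    have h2 : S.f ≫ ψ = ModuleCat.ofHom φ := by
      apply Abelian.Ext.addEquiv₀.symm.injective
      simpa using hx
    exact congrArg ModuleCat.Hom.hom h2

lemma subsingleton_ext_ker {P M : Type u} [AddCommGroup P] [Module R P] [Module.Free R P]
    [AddCommGroup M] [Module R M] {f : P →ₗ[R] M} (hf : Function.Surjective f)
    (Y : ModuleCat.{u} R)
    (hM : ∀ i, 0 < i → Subsingleton (Abelian.Ext (ModuleCat.of R M) Y i)) (i : ℕ) (hi : 0 < i) :
    Subsingleton (Abelian.Ext (ModuleCat.of R (LinearMap.ker f)) Y i) := by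
  have hS := LinearMap.shortExact_shortComplexKer hf
  refine hS.subsingleton_ext_X₁ Y ?_ (hM (i + 1) (by lia))
  obtain ⟨j, rfl⟩ := Nat.exists_eq_add_of_lt hi
  have : Projective (ModuleCat.of R P) :=
    ModuleCat.projective_of_free (Module.Free.chooseBasis R P)
  exact subsingleton_of_forall_eq 0 fun e =>
    Abelian.Ext.eq_zero_of_projective (P := ModuleCat.of R P) e

/-- If `Ext^i(M, R) = 0` for all `i > 0`, the dual of `M` is an arbitrarily high syzygy. -/
lemma isNthSyzygy_dual [IsNoetherianRing R] (t : ℕ) (M : Type u) [AddCommGroup M] [Module R M]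
    [Module.Finite R M]
    (hM : ∀ i, 0 < i → Subsingleton (Abelian.Ext (ModuleCat.of R M) (ModuleCat.of R R) i)) :
    IsNthSyzygy R t (ModuleCat.of R (Module.Dual R M)) := by
  induction t generalizing M with
  | zero => trivial
  | succ t ih =>
    obtain ⟨P, _, _, _, _, f, hf⟩ := Module.exists_finite_presentation R M
    have hS := LinearMap.shortExact_shortComplexKer hf
    exact ⟨_, _, _, _, _, inferInstanceAs (Module.Free R (Module.Dual R P)),
      hS.dual (hM 1 one_pos), ih (LinearMap.ker f) (subsingleton_ext_ker hf _ hM)⟩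

variable [IsNoetherianRing R] {n : ℕ}

lemma subsingleton_ext_dual
    (hR : HasInjectiveDimensionLT (ModuleCat.of R R) n) (M : Type u) [AddCommGroup M] [Module R M]
    [Module.Finite R M]
    (hM : ∀ i, 0 < i → Subsingleton (Abelian.Ext (ModuleCat.of R M) (ModuleCat.of R R) i))
    (i : ℕ) (hi : 0 < i) :
    Subsingleton
      (Abelian.Ext (ModuleCat.of R (Module.Dual R M)) (ModuleCat.of R R) i) := by
  obtain ⟨C, hC⟩ := (isNthSyzygy_dual n M hM).exists_subsingleton_ext (ModuleCat.of R R)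
  exact hC i hi (hR.subsingleton _ n (i + n) (by lia) C)

lemma surjective_eval_of_subsingleton_ext
    (hR : HasInjectiveDimensionLT (ModuleCat.of R R) n) (M : Type u) [AddCommGroup M] [Module R M]
    [Module.Finite R M]
    (hM : ∀ i, 0 < i → Subsingleton (Abelian.Ext (ModuleCat.of R M) (ModuleCat.of R R) i)) :
    Function.Surjective (Module.Dual.eval R M) := by
  obtain ⟨P, _, _, _, _, f, hf⟩ := Module.exists_finite_presentation R M
  have hS := ((LinearMap.shortExact_shortComplexKer hf).dual (hM 1 one_pos)).dual
    (subsingleton_ext_dual hR (LinearMap.ker f) (subsingleton_ext_ker hf _ hM) 1 one_pos)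
  intro y
  obtain ⟨z, rfl⟩ : ∃ z, f.dualMap.dualMap z = y := hS.moduleCat_surjective_g y
  obtain ⟨p, rfl⟩ := (Module.bijective_dual_eval R P).2 z
  exact ⟨f p, rfl⟩

lemma bijective_eval_of_subsingleton_ext
    (hR : HasInjectiveDimensionLT (ModuleCat.of R R) n) (M : Type u) [AddCommGroup M] [Module R M]
    [Module.Finite R M]
    (hM : ∀ i, 0 < i → Subsingleton (Abelian.Ext (ModuleCat.of R M) (ModuleCat.of R R) i)) :
    Function.Bijective (Module.Dual.eval R M) := by
  refine ⟨?_, surjective_eval_of_subsingleton_ext hR M hM⟩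
  obtain ⟨P, _, _, _, _, f, hf⟩ := Module.exists_finite_presentation R M
  have hK := subsingleton_ext_ker hf _ hM
  have hS := ((LinearMap.shortExact_shortComplexKer hf).dual (hM 1 one_pos)).dual
    (subsingleton_ext_dual hR (LinearMap.ker f) hK 1 one_pos)
  have hex : Function.Exact (LinearMap.ker f).subtype.dualMap.dualMap f.dualMap.dualMap :=
    (ShortComplex.ShortExact.moduleCat_exact_iff_function_exact _).1 hS.exact
  rw [injective_iff_map_eq_zero]
  intro m hm
  obtain ⟨p, rfl⟩ := hf m
  obtain ⟨z, hz⟩ := (hex (Module.Dual.eval R P p)).1 hm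
  obtain ⟨k, rfl⟩ := surjective_eval_of_subsingleton_ext hR (LinearMap.ker f) hK z
  have hkp : (k : P) = p := (Module.bijective_dual_eval R P).1 hz
  rw [← hkp]
  exact k.2

/-- Over a Noetherian ring of finite self-injective dimension, a finite module `M` with
`Ext^i(M, R) = 0` for all `i > 0` is totally reflexive. -/
lemma totallyReflexive_of_subsingleton_ext
    (hR : HasInjectiveDimensionLT (ModuleCat.of R R) n) (M : ModuleCat.{u} R)
    [Module.Finite R M]
    (hM : ∀ i, 0 < i → Subsingleton (Abelian.Ext M (ModuleCat.of R R) i)) :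
    TotallyReflexive R M :=
  ⟨bijective_eval_of_subsingleton_ext hR M hM,
    fun i hi => (subsingleton_extMod_iff hi _ _).2 (hM i hi),
    fun i hi => (subsingleton_extMod_iff hi _ _).2 (subsingleton_ext_dual hR M hM i hi)⟩

lemma Module.finite_dual (M : Type u) [AddCommGroup M] [Module R M] [Module.Finite R M] :
    Module.Finite R (Module.Dual R M) := by
  obtain ⟨P, _, _, _, _, f, hf⟩ := Module.exists_finite_presentation R M
  have : Module.Finite R (Module.Dual R P) := inferInstance
  exact Module.Finite.of_injective f.dualMap (LinearMap.dualMap_injective_of_surjective hf)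

/-- Finite totally reflexive modules are arbitrarily high syzygies. -/
lemma TotallyReflexive.isNthSyzygy {M : ModuleCat.{u} R} [Module.Finite R M]
    (hM : TotallyReflexive R M) (t : ℕ) : IsNthSyzygy R t M := by
  have : Module.Finite R (Module.Dual R M) := Module.finite_dual M
  exact (isNthSyzygy_dual t (Module.Dual R M)
    fun i hi => (subsingleton_extMod_iff hi _ _).1 (hM.2.2 i hi)).of_linearEquiv
    (LinearEquiv.ofBijective _ hM.1)

end Dual

section InjectiveDimension

variable {R}

/-- **Baer's criterion** in degree `r + 1`: to bound the injective dimension it suffices to test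
on finite modules. -/
lemma hasInjectiveDimensionLT_of_forall_finite (r : ℕ) (N : ModuleCat.{u} R)
    (h : ∀ X : ModuleCat.{u} R, Module.Finite R X → Subsingleton (Abelian.Ext X N (r + 1))) :
    HasInjectiveDimensionLT N (r + 1) := by
  induction r generalizing N with
  | zero =>
    rw [zero_add, ← injective_iff_hasInjectiveDimensionLT_one,
      ← Module.injective_iff_injective_object, ← Module.Baer.iff_injective]
    intro I φ
    have hS : (I.mkQ.shortComplexKer).ShortExact :=
      LinearMap.shortExact_shortComplexKer I.mkQ_surjective
    have := h (ModuleCat.of R (R ⧸ I)) inferInstance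
    obtain ⟨x, hx⟩ := Abelian.Ext.contravariant_sequence_exact₁ hS N
      (Abelian.Ext.mk₀ (ModuleCat.ofHom
        (φ ∘ₗ (LinearEquiv.ofEq _ _ I.ker_mkQ).toLinearMap))) (add_zero 1)
      (Subsingleton.elim _ _)
    obtain ⟨ψ, rfl⟩ := Abelian.Ext.addEquiv₀.symm.surjective x
    refine ⟨ψ.hom, fun x hx' => ?_⟩
    have h2 : I.mkQ.shortComplexKer.f ≫ ψ = ModuleCat.ofHom
        (φ ∘ₗ (LinearEquiv.ofEq _ _ I.ker_mkQ).toLinearMap) := by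
      apply Abelian.Ext.addEquiv₀.symm.injective
      simpa using hx
    exact ConcreteCategory.congr_hom h2 (⟨x, by simpa using hx'⟩ : LinearMap.ker I.mkQ)
  | succ r ih =>
    have ei : EnoughInjectives (ModuleCat.{u} R) := inferInstance
    obtain ⟨J, _, f, _⟩ := ei.1 N
    have hS : (ShortComplex.mk f (Limits.cokernel.π f) (Limits.cokernel.condition f)).ShortExact :=
      { exact := ShortComplex.exact_cokernel f }
    refine (hS.hasInjectiveDimensionLT_X₃_iff r inferInstance).1 (ih _ fun X hX => ?_)
    have := h X hX
    refine subsingleton_of_forall_eq 0 fun x => ?_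
    obtain ⟨y, rfl⟩ := Abelian.Ext.covariant_sequence_exact₃ X hS x rfl (Subsingleton.elim _ _)
    rw [y.eq_zero_of_injective, Abelian.Ext.zero_comp]

variable [IsLocalRing R] [IsNoetherianRing R]

lemma subsingleton_ext_quotient_prime {r : ℕ} {N : ModuleCat.{u} R} [Module.Finite R N]
    (hN : HasInjectiveDimensionLT N (r + 1)) (p : Ideal R) [p.IsPrime]
    (hp : p ≠ IsLocalRing.maximalIdeal R) :
    Subsingleton (Abelian.Ext (ModuleCat.of R (R ⧸ p)) N r) := by
  obtain ⟨x, hx, hxp⟩ : ∃ x ∈ IsLocalRing.maximalIdeal R, x ∉ p :=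
    SetLike.exists_of_lt ((IsLocalRing.le_maximalIdeal Ideal.IsPrime.ne_top').lt_of_ne hp)
  have hreg : IsSMulRegular (ModuleCat.of R (R ⧸ p)) x := by
    rw [isSMulRegular_iff_right_eq_zero_of_smul]
    intro y hy
    have : Ideal.Quotient.mk p x * y = 0 := by
      simpa [Algebra.smul_def] using hy
    exact (mul_eq_zero.1 this).resolve_left (by rwa [Ideal.Quotient.eq_zero_iff_mem])
  have hS := hreg.smulShortComplex_shortExact
  have htop : (⊤ : Submodule R (Abelian.Ext (ModuleCat.of R (R ⧸ p)) N r)) = ⊥ := by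
    refine Submodule.eq_bot_of_le_smul_of_le_jacobson_bot (IsLocalRing.maximalIdeal R) _
      Module.Finite.fg_top ?_ (IsLocalRing.maximalIdeal_le_jacobson _)
    intro e _
    have := hN.subsingleton _ (r + 1) (r + 1) le_rfl
      (ModuleCat.smulShortComplex (ModuleCat.of R (R ⧸ p)) x).X₃
    obtain ⟨y, rfl⟩ := Abelian.Ext.contravariant_sequence_exact₁ hS N e (add_comm 1 r)
      (Subsingleton.elim _ _)
    have key (z : Abelian.Ext (ModuleCat.of R (R ⧸ p)) N r) :
        (Abelian.Ext.mk₀ (x • 𝟙 (ModuleCat.of R (R ⧸ p)))).comp z (zero_add r) = x • z := by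
      rw [Abelian.Ext.mk₀_smul, Abelian.Ext.smul_comp, Abelian.Ext.mk₀_id_comp]
    rw [ModuleCat.smulShortComplex_f_eq_smul_id]
    exact (key y).symm ▸ Submodule.smul_mem_smul hx trivial
  exact (Submodule.subsingleton_iff R).1 (subsingleton_of_bot_eq_top htop.symm)

lemma subsingleton_ext_of_residueField {r : ℕ} {N : ModuleCat.{u} R} [Module.Finite R N]
    (hN : HasInjectiveDimensionLT N (r + 1))
    (hk : Subsingleton (Abelian.Ext
      (ModuleCat.of R (R ⧸ IsLocalRing.maximalIdeal R)) N r))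
    (X : ModuleCat.{u} R) [hX : Module.Finite R X] : Subsingleton (Abelian.Ext X N r) := by
  refine IsNoetherianRing.induction_on_isQuotientEquivQuotientPrime (M := X) R hX
    (motive := fun Y _ _ _ => Subsingleton (Abelian.Ext (ModuleCat.of R Y) N r)) ?_ ?_ ?_
  · intro Y _ _ _ _
    have hY : Limits.IsZero (ModuleCat.of R Y) := ModuleCat.isZero_of_subsingleton _
    refine subsingleton_of_forall_eq 0 fun e => ?_
    rw [← Abelian.Ext.mk₀_id_comp e, hY.eq_of_src (𝟙 _) 0, Abelian.Ext.mk₀_zero,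
      Abelian.Ext.zero_comp]
  · intro Y _ _ _ p e
    have h : Subsingleton (Abelian.Ext (ModuleCat.of R (R ⧸ p.1)) N r) := by
      by_cases hp : p.1 = IsLocalRing.maximalIdeal R
      · rwa [hp]
      · exact subsingleton_ext_quotient_prime hN p.1 hp
    refine subsingleton_of_forall_eq 0 fun x => ?_
    have := Subsingleton.elim
      ((Abelian.Ext.mk₀ e.toModuleIso.inv).comp x (zero_add r)) 0
    rw [← Abelian.Ext.mk₀_id_comp x]
    change (Abelian.Ext.mk₀ (𝟙 (ModuleCat.of R Y))).comp x _ = 0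
    rw [← e.toModuleIso.hom_inv_id, ← Abelian.Ext.mk₀_comp_mk₀_assoc, this,
      Abelian.Ext.comp_zero]
  · intro Y₁ _ _ _ Y₂ _ _ _ Y₃ _ _ _ f g hf hg hfg h₁ h₃
    have hS := ModuleCat.shortComplex_shortExact
      (ModuleCat.shortComplexOfCompEqZero f g hfg.linearMap_comp_eq_zero) hfg hf hg
    exact hS.subsingleton_ext_X₂ N h₁ h₃

/-- The residue field embeds into the quotient by a maximal regular sequence. -/
lemma exists_injective_residueField_of_isRegular_maximal {rs : List R}
    (hmem : ∀ r ∈ rs, r ∈ IsLocalRing.maximalIdeal R)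
    (hreg : RingTheory.Sequence.IsRegular R rs)
    (hmax : ∀ r ∈ IsLocalRing.maximalIdeal R, ¬ RingTheory.Sequence.IsRegular R (rs ++ [r])) :
    ∃ f : (R ⧸ IsLocalRing.maximalIdeal R) →ₗ[R] (R ⧸ Ideal.ofList rs),
      Function.Injective f := by
  have hne : ¬ Subsingleton
      ((R ⧸ IsLocalRing.maximalIdeal R) →ₗ[R] (R ⧸ Ideal.ofList rs)) := by
    rw [IsSMulRegular.subsingleton_linearMap_iff]
    rintro ⟨r, hr, hr'⟩
    rw [Ideal.annihilator_quotient] at hr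
    refine hmax r hr (.of_isWeaklyRegular_of_mem_maximalIdeal R ?_ ?_)
    · intro s hs
      rcases List.mem_append.1 hs with h | h
      · exact hmem s h
      · rwa [List.mem_singleton.1 h]
    · rw [RingTheory.Sequence.isWeaklyRegular_append_iff]
      refine ⟨hreg.1, ?_⟩
      rw [RingTheory.Sequence.isWeaklyRegular_singleton_iff]
      have e : (Ideal.ofList rs • ⊤ : Submodule R R) = Ideal.ofList rs := by simp
      rwa [e]
  obtain ⟨f, hf⟩ : ∃ f : (R ⧸ IsLocalRing.maximalIdeal R) →ₗ[R] (R ⧸ Ideal.ofList rs),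
      f ≠ 0 := by
    by_contra! h
    exact hne (subsingleton_of_forall_eq 0 h)
  have : IsSimpleModule R (R ⧸ IsLocalRing.maximalIdeal R) :=
    isSimpleModule_iff_quot_maximal.2 ⟨_, inferInstance, ⟨LinearEquiv.refl _ _⟩⟩
  exact ⟨f, (LinearMap.injective_or_eq_zero f).resolve_right hf⟩

/-- If the finite module `N` has finite injective dimension, this dimension is at most the length
of any maximal `R`-regular sequence. -/
lemma hasInjectiveDimensionLT_of_isRegular_maximal {rs : List R}
    (hmem : ∀ r ∈ rs, r ∈ IsLocalRing.maximalIdeal R)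
    (hreg : RingTheory.Sequence.IsRegular R rs)
    (hmax : ∀ r ∈ IsLocalRing.maximalIdeal R, ¬ RingTheory.Sequence.IsRegular R (rs ++ [r]))
    {N : ModuleCat.{u} R} [Module.Finite R N] {n : ℕ} (hN : HasInjectiveDimensionLT N n) :
    HasInjectiveDimensionLT N (rs.length + 1) := by
  induction n with
  | zero => exact hasInjectiveDimensionLT_of_ge N 0 _ (Nat.zero_le _)
  | succ n ih =>
    rcases Nat.lt_or_ge rs.length n with hn | hn
    · refine ih ?_
      obtain ⟨f, hf⟩ := exists_injective_residueField_of_isRegular_maximal hmem hreg hmax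
      have hpd : HasProjectiveDimensionLE (ModuleCat.of R (R ⧸ Ideal.ofList rs)) rs.length := by
        rw [← projectiveDimension_le_iff, ← ModuleCat.projectiveDimension_quotient_eq_length rs hreg,
          projectiveDimension_eq_of_iso (Shrink.linearEquiv R (R ⧸ Ideal.ofList rs)).toModuleIso]
      have hS : (ModuleCat.shortComplexOfCompEqZero f (LinearMap.range f).mkQ
          f.exact_map_mkQ_range.linearMap_comp_eq_zero).ShortExact :=
        ModuleCat.shortComplex_shortExact _ f.exact_map_mkQ_range hf
          (Submodule.mkQ_surjective _)
      have hk := hS.subsingleton_ext_X₁ N (hpd.subsingleton _ _ n hn N)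
        (hN.subsingleton _ (n + 1) (n + 1) le_rfl _)
      obtain ⟨m, rfl⟩ := Nat.exists_eq_succ_of_ne_zero (Nat.ne_zero_of_lt hn)
      exact hasInjectiveDimensionLT_of_forall_finite m N fun X _ =>
        subsingleton_ext_of_residueField hN hk X
    · exact hasInjectiveDimensionLT_of_ge N (n + 1) _ (by lia)

lemma IsGorensteinLocal.hasInjectiveDimensionLT (hR : IsGorensteinLocal R) :
    HasInjectiveDimensionLT (ModuleCat.of R R) (depth R (ModuleCat.of R R) + 1) := by
  obtain ⟨-, -, n, hn⟩ := hR
  have hinj : HasInjectiveDimensionLT (ModuleCat.of R R) (n + 1) :=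
    hasInjectiveDimensionLT_of_enoughProjectives _ _ fun Y =>
      (subsingleton_extMod_iff n.succ_pos _ _).1 (hn Y (n + 1) n.lt_succ_self)
  let T := {n | ∃ rs : List R, rs.length = n ∧ (∀ r ∈ rs, r ∈ IsLocalRing.maximalIdeal R) ∧
    RingTheory.Sequence.IsRegular (ModuleCat.of R R) rs}
  have hbdd : BddAbove T := by
    obtain ⟨d, hd⟩ : ∃ d : ℕ, ringKrullDim R ≤ d := by
      obtain ⟨d, hd⟩ := WithBot.ne_bot_iff_exists.1 (ringKrullDim_ne_bot (R := R))
      have htop := ringKrullDim_ne_top (R := R)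
      rw [← hd] at htop ⊢
      obtain ⟨n, rfl⟩ := ENat.ne_top_iff_exists.1 (fun h : d = ⊤ => htop (by rw [h]; rfl))
      exact ⟨n, le_rfl⟩
    refine ⟨d, ?_⟩
    rintro _ ⟨rs, rfl, -, hrs⟩
    have h := ringKrullDim_add_length_eq_ringKrullDim_of_isRegular rs hrs
    have : Nontrivial (R ⧸ Ideal.ofList rs) :=
      Ideal.Quotient.nontrivial_iff.2 fun h => hrs.2 (by simp [h])
    have h0 : (0 : WithBot ℕ∞) ≤ ringKrullDim (R ⧸ Ideal.ofList rs) :=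
      ringKrullDim_nonneg_of_nontrivial
    have h1 : (rs.length : WithBot ℕ∞) ≤ d :=
      (le_add_of_nonneg_left h0).trans (h.le.trans hd)
    exact_mod_cast h1
  obtain ⟨rs, hlen, hmem, hreg⟩ : depth R (ModuleCat.of R R) ∈ T :=
    Nat.sSup_mem ⟨0, [], rfl, by simp, RingTheory.Sequence.IsRegular.nil R R⟩ hbdd
  rw [← hlen]
  refine hasInjectiveDimensionLT_of_isRegular_maximal hmem hreg (fun r hr hrs => ?_) hinj
  have h : rs.length + 1 ≤ depth R (ModuleCat.of R R) := by
    refine le_csSup hbdd ⟨rs ++ [r], by simp, ?_, hrs⟩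
    intro s hs
    rcases List.mem_append.1 hs with h | h
    · exact hmem s h
    · rwa [List.mem_singleton.1 h]
  lia

end InjectiveDimension

lemma syz_eq_depth_iff {R} [CommRing R] [IsLocalRing R] (M : ModuleCat.{u} R) :
    syz R M = depth R (ModuleCat.of R R) ↔ IsNthSyzygy R (depth R (ModuleCat.of R R)) M := by
  have hbdd : BddAbove {t | t ≤ depth R (ModuleCat.of R R) ∧ IsNthSyzygy R t M} :=
    ⟨_, fun t ht => ht.1⟩
  have hne : {t | t ≤ depth R (ModuleCat.of R R) ∧ IsNthSyzygy R t M}.Nonempty :=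
    ⟨0, Nat.zero_le _, trivial⟩
  constructor
  · intro h
    have := (Nat.sSup_mem hne hbdd).2
    rwa [← h]
  · intro h
    exact le_antisymm (csSup_le hne fun t ht => ht.1) (le_csSup hbdd ⟨le_rfl, h⟩)

theorem stmt14 (R : Type u) [CommRing R] [IsLocalRing R] [IsNoetherianRing R]
    (hgor : IsGorensteinLocal R)
    (M : ModuleCat.{u} R) (hfg : Module.Finite R M) (hGdim : Gdim R M ≠ ⊤) :
    syz R M = depth R (ModuleCat.of R R) ↔ TotallyReflexive R M := by
  have hR := hgor.hasInjectiveDimensionLT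
  rw [syz_eq_depth_iff]
  constructor
  · intro h
    obtain ⟨C, hC⟩ := h.exists_subsingleton_ext (ModuleCat.of R R)
    exact totallyReflexive_of_subsingleton_ext hR M fun i hi =>
      hC i hi (hR.subsingleton _ _ _ (by lia) C)
  · intro h
    exact h.isNthSyzygy _
end
end
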